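/- Let M be a right R-module, let F ⊆ U(M^∞) satisfy the chain condition, let X ⊆ M^∞ be a subset, and let d be an integer. Assume that the poset O(X) ∩ F is d-connected and that for every sequence (v_1,…,v_m) ∈ F \ O(X) the poset O(X) ∩ F_{(v_1,…,v_m)} is (d − m)-connected. Then F is d-connected. -/

import Mathlib

open CategoryTheory MulOpposite

/-- `O(V)`: the poset of ordered sequences of distinct elements of `V`, of length at least
one, ordered by refinement (i.e. by the sublist relation). -/
def OSeq (V : Type u) : Type u := {l : List V // l ≠ [] ∧ l.Nodup}

instance (V : Type u) : PartialOrder (OSeq V) where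
  le a b := a.1.Sublist b.1
  le_refl a := List.Sublist.refl a.1
  le_trans a b c hab hbc := List.Sublist.trans hab hbc
  le_antisymm a b h h' := Subtype.ext (List.Sublist.antisymm h h')

/-- A space is `d`-connected (for an integer `d`) if it is nonempty and all its homotopy
groups in degrees `≤ d` vanish; for `d ≤ -2` the condition is vacuous. -/
def TopDConnected (X : Type*) [TopologicalSpace X] (d : ℤ) : Prop :=
  d ≤ -2 ∨
    (Nonempty X ∧ ∀ (n : ℕ), (n : ℤ) ≤ d → ∀ x : X, Subsingleton (HomotopyGroup (Fin n) X x))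

/-- A poset is `d`-connected if the geometric realization of its order complex (nerve) is. -/
def PosetDConnected (P : Type) [PartialOrder P] (d : ℤ) : Prop :=
  TopDConnected (SSet.toTop.obj (nerve P)) d

/-- A set of sequences is `d`-connected if it is so as a subposet of `O(V)`. -/
def SetDConnected {V : Type} (F : Set (OSeq V)) (d : ℤ) : Prop :=
  PosetDConnected F d

/-- `F ⊆ O(V)` satisfies the chain condition: it is downwards closed for refinement. -/
def ChainCondition {V : Type u} (F : Set (OSeq V)) : Prop :=
  ∀ ⦃w v : OSeq V⦄, w ≤ v → v ∈ F → w ∈ F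

/-- `F_v`: the subposet of sequences `w ∈ F` whose concatenation with `v` again lies in `F`. -/
def SeqExt {V : Type u} (F : Set (OSeq V)) (v : OSeq V) : Set (OSeq V) :=
  {w | w ∈ F ∧ ∃ h : w.1 ++ v.1 ≠ [] ∧ (w.1 ++ v.1).Nodup, (⟨w.1 ++ v.1, h⟩ : OSeq V) ∈ F}

/-- `O(X)` inside `O(V)`: sequences all of whose entries lie in `X`. -/
def SeqIn {V : Type u} (X : Set V) : Set (OSeq V) :=
  {w | ∀ x ∈ w.1, x ∈ X}

/-- A sequence `v` in a right `R`-module `M` (viewed as a left `Rᵐᵒᵖ`-module) is unimodular. -/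
def IsUnimodularSeq (R : Type*) [Ring R] (M : Type*) [AddCommGroup M] [Module Rᵐᵒᵖ M]
    {n : ℕ} (v : Fin n → M) : Prop :=
  ∃ (f : Fin n → (R →ₗ[Rᵐᵒᵖ] M)) (φ : Fin n → (M →ₗ[Rᵐᵒᵖ] R)),
    (∀ i, f i 1 = v i) ∧ ∀ i j, (φ j).comp (f i) = if i = j then LinearMap.id else 0

/-- `M^∞ := M ⊕ R^∞`, where `R^∞` is free with basis `e_1, e_2, …`. -/
abbrev MInf (R : Type u) [Ring R] (M : Type u) [AddCommGroup M] [Module Rᵐᵒᵖ M] : Type u :=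
  M × (ℕ →₀ R)

/-- `U(W)`: the subposet of `O(W)` consisting of unimodular sequences in the module `W`. -/
def UnimodSeqs (R : Type*) [Ring R] (W : Type*) [AddCommGroup W] [Module Rᵐᵒᵖ W] :
    Set (OSeq W) :=
  {w | IsUnimodularSeq R W (fun i : Fin w.1.length => w.1.get i)}

/-- `R` satisfies the stable range condition `(S_s)`. -/
def SatisfiesStableRange (R : Type*) [Ring R] (s : ℕ) : Prop :=
  ∀ r : Fin (s + 1) → R,
    IsUnimodularSeq R (Fin (s + 1) → R) (fun _ : Fin 1 => r) →
      ∃ t : Fin s → R,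
        IsUnimodularSeq R (Fin s → R)
          (fun _ : Fin 1 => fun i => r i.castSucc + t i * r (Fin.last s))

section Connectivity

open Set Metric Topology

/-- A map `g` on the unit sphere of `ι → ℝ` (for the sup norm) extends to a continuous map from the
unit ball to `S`. -/
def Fills {ι : Type*} [Fintype ι] {Y : Type*} [TopologicalSpace Y] (S : Set Y)
    (g : (ι → ℝ) → Y) : Prop :=
  ∃ G : (ι → ℝ) → Y, ContinuousOn G (closedBall 0 1) ∧ EqOn G g (sphere 0 1) ∧
    MapsTo G (closedBall 0 1) S

/-- `S` is nonempty and every continuous map from the unit sphere of `ι → ℝ` to `S` extends to the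
unit ball. -/
def FillsSpheres (ι : Type*) [Fintype ι] {Y : Type*} [TopologicalSpace Y] (S : Set Y) : Prop :=
  S.Nonempty ∧ ∀ g : (ι → ℝ) → Y, ContinuousOn g (sphere 0 1) → MapsTo g (sphere 0 1) S →
    Fills S g

section Fills

variable {ι κ : Type*} [Fintype ι] [Fintype κ] {Y Z : Type*} [TopologicalSpace Y]
  [TopologicalSpace Z] {S S' : Set Y}

theorem Fills.mono {g : (ι → ℝ) → Y} (h : Fills S g) (hS : S ⊆ S') : Fills S' g := by
  obtain ⟨G, h1, h2, h3⟩ := h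
  exact ⟨G, h1, h2, h3.mono_right hS⟩

theorem Fills.comp {g : (ι → ℝ) → Y} {f : Y → Z} {T : Set Z} (h : Fills S g)
    (hf : ContinuousOn f S) (hST : MapsTo f S T) : Fills T (f ∘ g) := by
  obtain ⟨G, h1, h2, h3⟩ := h
  exact ⟨f ∘ G, hf.comp h1 h3, fun x hx => congrArg f (h2 hx), hST.comp h3⟩

theorem Fills.congr {g g' : (ι → ℝ) → Y} (h : Fills S g) (hg : EqOn g g' (sphere 0 1)) :
    Fills S g' := by
  obtain ⟨G, h1, h2, h3⟩ := h
  exact ⟨G, h1, h2.trans hg, h3⟩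

theorem fills_const {y : Y} (hy : y ∈ S) : Fills S (fun _ : ι → ℝ => y) :=
  ⟨fun _ => y, continuousOn_const, fun _ _ => rfl, fun _ _ => hy⟩

theorem fillsSpheres_singleton (y : Y) : FillsSpheres ι ({y} : Set Y) :=
  ⟨singleton_nonempty y, fun _ _ hg => (fills_const (mem_singleton y)).congr
    fun _ hx => (mem_singleton_iff.1 (hg hx)).symm⟩

/-- Whether a map on the sphere extends to the ball depends only on its homotopy class. -/
theorem Fills.of_homotopy {g : (ι → ℝ) → Y} (H : ℝ × (ι → ℝ) → Y)
    (hH : ContinuousOn H (Icc 0 1 ×ˢ sphere 0 1)) (hHS : MapsTo H (Icc 0 1 ×ˢ sphere 0 1) S)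
    (h0 : ∀ x ∈ sphere (0 : ι → ℝ) 1, H (0, x) = g x)
    (h1 : Fills S fun x => H (1, x)) : Fills S g := by
  classical
  obtain ⟨G, hG, hGg, hGS⟩ := h1
  set A : Set (ι → ℝ) := {x | 1 / 2 ≤ ‖x‖ ∧ ‖x‖ ≤ 1}
  set B : Set (ι → ℝ) := closedBall 0 (1 / 2)
  let p : (ι → ℝ) → ℝ × (ι → ℝ) := fun x => (2 * (1 - ‖x‖), ‖x‖⁻¹ • x)
  have hpA : MapsTo p A (Icc 0 1 ×ˢ sphere 0 1) := by
    rintro x ⟨hx1, hx2⟩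
    refine ⟨⟨by simp only [p]; linarith, by simp only [p]; linarith⟩, ?_⟩
    have : ‖x‖ ≠ 0 := by linarith
    simp [p, norm_smul, this]
  have hpc : ContinuousOn p A := by
    refine ContinuousOn.prodMk (by fun_prop) (ContinuousOn.smul (continuous_norm.continuousOn.inv₀ ?_)
      continuousOn_id)
    rintro x ⟨hx1, hx2⟩
    linarith
  have hBm : MapsTo (fun x : ι → ℝ => (2 : ℝ) • x) B (closedBall 0 1) := by
    intro x hx
    simp only [B, mem_closedBall, dist_zero_right, norm_smul] at hx ⊢
    norm_num
    linarith
  have hAB : closedBall (0 : ι → ℝ) 1 = A ∪ B := by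
    ext x
    simp only [A, B, mem_closedBall, dist_zero_right, mem_union, mem_ofPred_eq]
    constructor
    · intro h
      rcases le_total (1 / 2) ‖x‖ with h' | h'
      · exact Or.inl ⟨h', h⟩
      · exact Or.inr h'
    · rintro (h | h)
      · exact h.2
      · linarith
  have hAc : IsClosed A :=
    (isClosed_le continuous_const continuous_norm).inter (isClosed_le continuous_norm continuous_const)
  let K : (ι → ℝ) → Y := fun x => if x ∈ A then H (p x) else G ((2 : ℝ) • x)
  have hKA : EqOn K (H ∘ p) A := fun x hx => if_pos hx
  have hKB : EqOn K (fun x => G ((2 : ℝ) • x)) B := by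
    intro x hx
    by_cases hxA : x ∈ A
    · have hx2 : ‖x‖ = 1 / 2 := le_antisymm (by simpa [B] using hx) hxA.1
      have hpx : p x = (1, (2 : ℝ) • x) := by simp only [p, hx2]; norm_num
      have hm : (2 : ℝ) • x ∈ sphere (0 : ι → ℝ) 1 := by simp [norm_smul, hx2]
      simp only [K, if_pos hxA, hpx]
      exact (hGg hm).symm
    · exact if_neg hxA
  refine ⟨K, ?_, ?_, ?_⟩
  · rw [hAB]
    refine ContinuousOn.union_of_isClosed ?_ ?_ hAc isClosed_closedBall
    · exact (hH.comp hpc hpA).congr hKA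
    · exact (hG.comp (by fun_prop) hBm).congr hKB
  · intro x hx
    have hx1 : ‖x‖ = 1 := by simpa using hx
    have hxA : x ∈ A := ⟨by rw [hx1]; norm_num, hx1.le⟩
    rw [hKA hxA, ← h0 x hx]
    simp [p, hx1]
  · rw [hAB]
    rintro x (hx | hx)
    · rw [hKA hx]; exact hHS (hpA hx)
    · rw [hKB hx]; exact hGS (hBm hx)

theorem norm_comp_equiv (e : ι ≃ κ) (x : κ → ℝ) : ‖x ∘ e‖ = ‖x‖ := by
  refine le_antisymm ?_ ?_
  · exact (pi_norm_le_iff_of_nonneg (norm_nonneg _)).2 fun i => norm_le_pi_norm x (e i)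
  · refine (pi_norm_le_iff_of_nonneg (norm_nonneg _)).2 fun i => ?_
    simpa using norm_le_pi_norm (x ∘ e) (e.symm i)

theorem FillsSpheres.congr_equiv (e : ι ≃ κ) (h : FillsSpheres ι S) : FillsSpheres κ S := by
  let φ : (ι → ℝ) → (κ → ℝ) := fun x => x ∘ e.symm
  let ψ : (κ → ℝ) → (ι → ℝ) := fun x => x ∘ e
  have hφ : Continuous φ := by fun_prop
  have hψ : Continuous ψ := by fun_prop
  have hφn : ∀ x, ‖φ x‖ = ‖x‖ := norm_comp_equiv e.symm
  have hψn : ∀ x, ‖ψ x‖ = ‖x‖ := norm_comp_equiv e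
  have hφs : MapsTo φ (sphere 0 1) (sphere 0 1) := fun x hx => by
    rw [mem_sphere_zero_iff_norm] at *; rw [hφn, hx]
  have hψs : MapsTo ψ (sphere 0 1) (sphere 0 1) := fun x hx => by
    rw [mem_sphere_zero_iff_norm] at *; rw [hψn, hx]
  have hψb : MapsTo ψ (closedBall 0 1) (closedBall 0 1) := fun x hx => by
    rw [mem_closedBall_zero_iff] at *; rw [hψn]; exact hx
  have hφψ : ∀ x, φ (ψ x) = x := fun x => by ext i; simp [φ, ψ]
  refine ⟨h.1, fun g hg hgS => ?_⟩
  obtain ⟨G, hG, hGg, hGS⟩ := h.2 (g ∘ φ) (hg.comp hφ.continuousOn hφs) (hgS.comp hφs)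
  refine ⟨G ∘ ψ, hG.comp hψ.continuousOn hψb, fun x hx => ?_, hGS.comp hψb⟩
  rw [Function.comp_apply, hGg (hψs hx), Function.comp_apply, hφψ]

end Fills

/-- A closed face of the integral cubical grid of `ι → ℝ`. -/
@[ext]
structure GridFace (ι : Type*) where
  lo : ι → ℤ
  hi : ι → ℤ
  lo_le_hi : ∀ i, lo i ≤ hi i
  hi_le_lo_add_one : ∀ i, hi i ≤ lo i + 1

namespace GridFace

variable {ι : Type*}

instance : PartialOrder (GridFace ι) where
  le e e' := e'.lo ≤ e.lo ∧ e.hi ≤ e'.hi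
  le_refl e := ⟨le_rfl, le_rfl⟩
  le_trans _ _ _ h h' := ⟨h'.1.trans h.1, h.2.trans h'.2⟩
  le_antisymm _ _ h h' := GridFace.ext (le_antisymm h'.1 h.1) (le_antisymm h.2 h'.2)

/-- The set of points of a face. -/
def cell (e : GridFace ι) : Set (ι → ℝ) := {x | ∀ i, (e.lo i : ℝ) ≤ x i ∧ x i ≤ e.hi i}

/-- The smallest face containing a point. -/
noncomputable def support (x : ι → ℝ) : GridFace ι where
  lo i := ⌊x i⌋
  hi i := ⌈x i⌉
  lo_le_hi i := Int.floor_le_ceil (x i)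
  hi_le_lo_add_one i := Int.ceil_le_floor_add_one (x i)

theorem mem_cell_iff {e : GridFace ι} {x : ι → ℝ} : x ∈ e.cell ↔ support x ≤ e := by
  constructor
  · intro h
    exact ⟨fun i => Int.le_floor.2 (h i).1, fun i => Int.ceil_le.2 (h i).2⟩
  · intro h i
    exact ⟨Int.le_floor.1 (h.1 i), Int.ceil_le.1 (h.2 i)⟩

theorem mem_cell_support (x : ι → ℝ) : x ∈ (support x).cell := mem_cell_iff.2 le_rfl

theorem isClosed_cell (e : GridFace ι) : IsClosed e.cell := by
  have : e.cell = Icc (fun i => (e.lo i : ℝ)) (fun i => (e.hi i : ℝ)) := by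
    ext x
    simp only [cell, mem_ofPred_eq, mem_Icc, Pi.le_def, forall_and]
  rw [this]
  exact isClosed_Icc

variable [Fintype ι]

theorem exists_fill_cell {Y : Type*} [TopologicalSpace Y] {S : Set Y} (e : GridFace ι)
    (hS : FillsSpheres {i // e.lo i < e.hi i} S) {g : (ι → ℝ) → Y}
    (hg : ContinuousOn g {x | support x < e}) (hgS : MapsTo g {x | support x < e} S) :
    ∃ G : (ι → ℝ) → Y, ContinuousOn G e.cell ∧ EqOn G g {x | support x < e} ∧
      MapsTo G e.cell S := by
  classical
  let φ : ({i // e.lo i < e.hi i} → ℝ) → (ι → ℝ) := fun y i =>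
    if h : e.lo i < e.hi i then e.lo i + (y ⟨i, h⟩ + 1) / 2 else e.lo i
  let ψ : (ι → ℝ) → ({i // e.lo i < e.hi i} → ℝ) := fun x j => 2 * (x j - e.lo j) - 1
  have hφ : Continuous φ := by
    refine continuous_pi fun i => ?_
    by_cases h : e.lo i < e.hi i
    · simp only [φ, h, dite_true]; fun_prop
    · simp only [φ, h, dite_false]; fun_prop
  have hψ : Continuous ψ := by fun_prop
  have hhi : ∀ i, e.lo i < e.hi i → (e.hi i : ℝ) = e.lo i + 1 := fun i hi => by
    have := e.hi_le_lo_add_one i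
    have : e.hi i = e.lo i + 1 := by omega
    rw [this]; push_cast; rfl
  have hφψ : ∀ x ∈ e.cell, φ (ψ x) = x := by
    intro x hx
    ext i
    by_cases h : e.lo i < e.hi i
    · simp only [φ, ψ, h, dite_true]; ring
    · have h1 := hx i
      have h2 : e.hi i = e.lo i := le_antisymm (not_lt.1 h) (e.lo_le_hi i)
      rw [h2] at h1
      simp only [φ, h, dite_false]
      exact le_antisymm h1.1 h1.2
  have hψb : MapsTo ψ e.cell (closedBall 0 1) := by
    intro x hx
    rw [mem_closedBall_zero_iff, pi_norm_le_iff_of_nonneg zero_le_one]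
    rintro ⟨i, hi⟩
    have h1 := hx i
    rw [hhi i hi] at h1
    rw [Real.norm_eq_abs, abs_le]
    constructor <;> simp only [ψ] <;> linarith
  have hsub : {x | support x < e} ⊆ e.cell := fun x hx => mem_cell_iff.2 (le_of_lt hx)
  have hψs : MapsTo ψ {x | support x < e} (sphere 0 1) := by
    intro x hx
    have hxc := hsub hx
    rw [mem_sphere_zero_iff_norm]
    refine le_antisymm (mem_closedBall_zero_iff.1 (hψb hxc)) ?_
    obtain ⟨i, hi, hxi⟩ : ∃ i, e.lo i < e.hi i ∧ (x i = e.lo i ∨ x i = e.hi i) := by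
      by_contra hcon
      push Not at hcon
      have hle : ∀ i, e.lo i ≤ ⌊x i⌋ ∧ ⌈x i⌉ ≤ e.hi i := fun i =>
        ⟨(mem_cell_iff.1 hxc).1 i, (mem_cell_iff.1 hxc).2 i⟩
      refine (ne_of_lt hx) (GridFace.ext (funext fun i => ?_) (funext fun i => ?_))
      · have h1 := hle i
        have h2 := e.hi_le_lo_add_one i
        have h3 := Int.floor_le_ceil (x i)
        change ⌊x i⌋ = e.lo i
        by_contra hne
        refine (hcon i (by omega)).2 (le_antisymm (hxc i).2 ?_)
        exact Int.le_floor.1 (by omega)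
      · have h1 := hle i
        have h2 := e.hi_le_lo_add_one i
        have h3 := Int.floor_le_ceil (x i)
        change ⌈x i⌉ = e.hi i
        by_contra hne
        refine (hcon i (by omega)).1 (le_antisymm ?_ (hxc i).1)
        exact Int.ceil_le.1 (by omega)
    refine le_trans (le_of_eq ?_) (norm_le_pi_norm (ψ x) ⟨i, hi⟩)
    rw [Real.norm_eq_abs]
    rcases hxi with h | h
    · simp only [ψ, h]; norm_num
    · simp only [ψ, h, hhi i hi]; norm_num
  have hφs : MapsTo φ (sphere 0 1) {x | support x < e} := by
    intro y hy
    rw [mem_sphere_zero_iff_norm] at hy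
    have hyc : φ y ∈ e.cell := by
      intro i
      by_cases h : e.lo i < e.hi i
      · have h1 := norm_le_pi_norm y ⟨i, h⟩
        rw [hy, Real.norm_eq_abs, abs_le] at h1
        simp only [φ, h, dite_true, hhi i h]
        constructor <;> linarith
      · simp only [φ, h, dite_false]
        exact ⟨le_rfl, by exact_mod_cast e.lo_le_hi i⟩
    refine lt_of_le_of_ne (mem_cell_iff.1 hyc) fun heq => ?_
    obtain ⟨⟨i, hi⟩, hyi⟩ : ∃ j, 1 ≤ ‖y j‖ := by
      by_contra hcon
      push Not at hcon
      exact absurd hy ((pi_norm_lt_iff zero_lt_one).2 hcon).ne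
    have h1 := norm_le_pi_norm y ⟨i, hi⟩
    rw [hy] at h1
    have h2 : φ y i = e.lo i + (y ⟨i, hi⟩ + 1) / 2 := by simp only [φ, hi, dite_true]
    have hlo : ⌊φ y i⌋ = e.lo i := congrFun (congrArg GridFace.lo heq) i
    have hhi' : ⌈φ y i⌉ = e.hi i := congrFun (congrArg GridFace.hi heq) i
    rcases eq_or_eq_neg_of_abs_eq (le_antisymm h1 hyi) with h | h
    · rw [h2, h] at hlo
      norm_num at hlo
    · rw [h2, h] at hhi'
      norm_num at hhi'
      omega
  obtain ⟨G, hG, hGg, hGS⟩ := hS.2 (g ∘ φ) (hg.comp hφ.continuousOn hφs) (hgS.comp hφs)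
  refine ⟨G ∘ ψ, hG.comp hψ.continuousOn hψb, fun x hx => ?_, hGS.comp hψb⟩
  rw [Function.comp_apply, hGg (hψs hx), Function.comp_apply, hφψ x (hsub hx)]

/-- Extension of maps with prescribed carriers over a finite complex of grid faces. -/
theorem exists_extension_of_carrier {Z : Type*} [TopologicalSpace Z] (E : Finset (GridFace ι))
    (hE : ∀ e ∈ E, ∀ e' ≤ e, e' ∈ E) (C : GridFace ι → Set Z)
    (hC : ∀ e e', e ≤ e' → C e ⊆ C e') (L : Finset (GridFace ι)) (hLE : L ⊆ E)
    (hL : ∀ e ∈ L, ∀ e' ≤ e, e' ∈ L)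
    (hfill : ∀ e ∈ E, e ∉ L → FillsSpheres {i // e.lo i < e.hi i} (C e))
    (g : (ι → ℝ) → Z) (hg : ContinuousOn g {x | support x ∈ L})
    (hgC : ∀ x, support x ∈ L → g x ∈ C (support x)) :
    ∃ G : (ι → ℝ) → Z, ContinuousOn G {x | support x ∈ E} ∧
      EqOn G g {x | support x ∈ L} ∧ ∀ x, support x ∈ E → G x ∈ C (support x) := by
  classical
  induction hn : (E \ L).card generalizing L g with
  | zero =>
    have : E = L := (Finset.sdiff_eq_empty_iff_subset.1 (Finset.card_eq_zero.1 hn)).antisymm hLE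
    subst this
    exact ⟨g, hg, fun _ _ => rfl, hgC⟩
  | succ n ih =>
    obtain ⟨e, he⟩ : ∃ e, Minimal (· ∈ E \ L) e :=
      Finset.exists_minimal (Finset.card_pos.1 (by omega))
    obtain ⟨heE, heL⟩ := Finset.mem_sdiff.1 he.1
    have hlt : ∀ e' < e, e' ∈ L := fun e' he' => by
      by_contra hcon
      exact (he.not_prop_of_lt he') (Finset.mem_sdiff.2 ⟨hE e heE e' he'.le, hcon⟩)
    obtain ⟨G, hG, hGg, hGC⟩ := e.exists_fill_cell (hfill e heE heL) (g := g)
      (hg.mono fun x hx => hlt _ hx) (fun x hx => hC _ _ (le_of_lt hx) (hgC x (hlt _ hx)))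
    let g' : (ι → ℝ) → Z := fun x => if x ∈ e.cell then G x else g x
    have hg'e : EqOn g' G e.cell := fun x hx => if_pos hx
    have hg'L : EqOn g' g {x | support x ∈ L} := by
      intro x hx
      by_cases hxe : x ∈ e.cell
      · rw [hg'e hxe]
        refine hGg (lt_of_le_of_ne (mem_cell_iff.1 hxe) ?_)
        rintro rfl
        exact heL hx
      · exact if_neg hxe
    have hLc : IsClosed {x : ι → ℝ | support x ∈ L} := by
      have : {x : ι → ℝ | support x ∈ L} = ⋃ e ∈ L, e.cell := by
        ext x
        simp only [mem_ofPred_eq, mem_iUnion, exists_prop]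
        exact ⟨fun h => ⟨_, h, mem_cell_support x⟩, fun ⟨e', h, hx⟩ => hL e' h _ (mem_cell_iff.1 hx)⟩
      rw [this]
      exact L.finite_toSet.isClosed_biUnion fun e _ => isClosed_cell e
    have hun : {x : ι → ℝ | support x ∈ insert e L} = {x | support x ∈ L} ∪ e.cell := by
      ext x
      simp only [mem_ofPred_eq, mem_union, Finset.mem_insert, mem_cell_iff]
      constructor
      · rintro (h | h)
        · exact Or.inr h.le
        · exact Or.inl h
      · rintro (h | h)
        · exact Or.inr h
        · exact h.eq_or_lt.imp id (hlt _)
    obtain ⟨G', h1, h2, h3⟩ := ih (insert e L) (Finset.insert_subset heE hLE) (by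
        intro a ha b hb
        rcases Finset.mem_insert.1 ha with rfl | ha
        · rcases hb.eq_or_lt with rfl | hb
          · exact ha
          · exact Finset.mem_insert_of_mem (hlt _ hb)
        · exact Finset.mem_insert_of_mem (hL a ha b hb))
      (fun a ha haL => hfill a ha fun h => haL (Finset.mem_insert_of_mem h)) g' (by
        rw [hun]
        exact (hg.congr hg'L).union_of_isClosed (hG.congr hg'e) hLc (isClosed_cell e))
      (by
        intro x hx
        rcases Finset.mem_insert.1 hx with h | h
        · have hxe : x ∈ e.cell := mem_cell_iff.2 h.le
          rw [hg'e hxe, h]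
          exact hGC hxe
        · rw [hg'L h]
          exact hgC x h)
      (by
        rw [Finset.sdiff_insert, Finset.card_erase_of_mem he.1, hn]
        rfl)
    exact ⟨G', h1, fun x hx => (h2 (Finset.mem_insert_of_mem hx)).trans (hg'L hx), h3⟩

end GridFace

/-- Finite subsets carry the Alexandrov topology whose open sets are the upper sets. -/
instance finsetUpperSetTopology (P : Type*) : TopologicalSpace (Finset P) :=
  Topology.upperSet (Finset P)

section FinsetTopology

variable {P : Type*} {X : Type*} [TopologicalSpace X]

theorem isOpen_finset_iff {U : Set (Finset P)} : IsOpen U ↔ IsUpperSet U := Iff.rfl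

theorem continuousOn_finset_iff {f : X → Finset P} {A : Set X} :
    ContinuousOn f A ↔ ∀ x ∈ A, ∀ᶠ y in 𝓝[A] x, f x ⊆ f y := by
  constructor
  · intro h x hx
    exact (h x hx).eventually ((isOpen_finset_iff.2 (isUpperSet_Ici (f x))).mem_nhds self_mem_Ici)
  · intro h x hx U hU
    obtain ⟨V, hVU, hV, hxV⟩ := mem_nhds_iff.1 hU
    refine Filter.mem_map.2 ?_
    filter_upwards [h x hx] with y hy
    exact hVU (isOpen_finset_iff.1 hV hy hxV)

end FinsetTopology

namespace GridFace

variable {ι : Type*}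

theorem cell_mono {e e' : GridFace ι} (h : e ≤ e') : e.cell ⊆ e'.cell :=
  fun _ hx => mem_cell_iff.2 ((mem_cell_iff.1 hx).trans h)

theorem lo_mem_cell (e : GridFace ι) : (fun i => (e.lo i : ℝ)) ∈ e.cell :=
  fun i => ⟨le_rfl, Int.cast_le.2 (e.lo_le_hi i)⟩

variable [Fintype ι]

theorem dist_le_of_mem_cell {e : GridFace ι} {x y : ι → ℝ} (hx : x ∈ e.cell) (hy : y ∈ e.cell) :
    dist x y ≤ 1 := by
  refine (dist_pi_le_iff zero_le_one).2 fun i => ?_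
  have h : (e.hi i : ℝ) ≤ e.lo i + 1 := by exact_mod_cast e.hi_le_lo_add_one i
  have h1 := hx i
  have h2 := hy i
  rw [Real.dist_eq, abs_le]
  constructor <;> linarith

theorem finite_bounded (N : ℕ) :
    {e : GridFace ι | ∀ i, -(N : ℤ) ≤ e.lo i ∧ e.hi i ≤ N}.Finite := by
  classical
  refine Set.Finite.of_finite_image (f := fun e : GridFace ι => (e.lo, e.hi)) ?_ ?_
  · refine ((finite_Icc (fun _ : ι => -(N : ℤ)) fun _ => (N : ℤ)).prod
      (finite_Icc (fun _ : ι => -(N : ℤ)) fun _ => (N : ℤ))).subset ?_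
    rintro _ ⟨e, he, rfl⟩
    exact ⟨⟨fun i => (he i).1, fun i => (e.lo_le_hi i).trans (he i).2⟩,
      ⟨fun i => (he i).1.trans (e.lo_le_hi i), fun i => (he i).2⟩⟩
  · intro e _ e' _ h
    exact GridFace.ext (congrArg Prod.fst h) (congrArg Prod.snd h)

/-- The faces of the ball of radius `N`. -/
noncomputable def ballFaces (ι : Type*) [Fintype ι] (N : ℕ) : Finset (GridFace ι) :=
  (finite_bounded N).toFinset

theorem mem_ballFaces {N : ℕ} {e : GridFace ι} :
    e ∈ ballFaces ι N ↔ ∀ i, -(N : ℤ) ≤ e.lo i ∧ e.hi i ≤ N := by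
  simp [ballFaces]

open Classical in
/-- The faces of the sphere of radius `N`. -/
noncomputable def sphereFaces (ι : Type*) [Fintype ι] (N : ℕ) : Finset (GridFace ι) :=
  (ballFaces ι N).filter fun e => ∃ i, e.hi i = -N ∨ e.lo i = N

theorem mem_sphereFaces {N : ℕ} {e : GridFace ι} :
    e ∈ sphereFaces ι N ↔ e ∈ ballFaces ι N ∧ ∃ i, e.hi i = -N ∨ e.lo i = N := by
  simp [sphereFaces]

theorem ballFaces_lower {N : ℕ} {e e' : GridFace ι} (he : e ∈ ballFaces ι N) (h : e' ≤ e) :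
    e' ∈ ballFaces ι N :=
  mem_ballFaces.2 fun i =>
    ⟨(mem_ballFaces.1 he i).1.trans (h.1 i), (h.2 i).trans (mem_ballFaces.1 he i).2⟩

theorem sphereFaces_lower {N : ℕ} {e e' : GridFace ι} (he : e ∈ sphereFaces ι N) (h : e' ≤ e) :
    e' ∈ sphereFaces ι N := by
  obtain ⟨hb, i, hi⟩ := mem_sphereFaces.1 he
  have hb' := ballFaces_lower hb h
  refine mem_sphereFaces.2 ⟨hb', i, ?_⟩
  have h1 := mem_ballFaces.1 hb' i
  have h2 : e.lo i ≤ e'.lo i := h.1 i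
  have h3 : e'.hi i ≤ e.hi i := h.2 i
  have h4 := e'.lo_le_hi i
  omega

theorem card_lt_of_mem_sphereFaces {N : ℕ} {e : GridFace ι} (he : e ∈ sphereFaces ι N) :
    Fintype.card {i // e.lo i < e.hi i} < Fintype.card ι := by
  obtain ⟨hb, i, hi⟩ := mem_sphereFaces.1 he
  refine Fintype.card_subtype_lt (x := i) ?_
  have h1 := mem_ballFaces.1 hb i
  have h4 := e.lo_le_hi i
  omega

theorem support_mem_ballFaces {N : ℕ} {x : ι → ℝ} : support x ∈ ballFaces ι N ↔ ‖x‖ ≤ N := by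
  rw [mem_ballFaces, pi_norm_le_iff_of_nonneg (Nat.cast_nonneg N)]
  refine forall_congr' fun i => ?_
  rw [Real.norm_eq_abs, abs_le]
  change -(N : ℤ) ≤ ⌊x i⌋ ∧ ⌈x i⌉ ≤ N ↔ _
  rw [Int.le_floor, Int.ceil_le]
  push_cast
  rfl

theorem support_mem_sphereFaces {N : ℕ} (hN : 0 < N) {x : ι → ℝ} :
    support x ∈ sphereFaces ι N ↔ ‖x‖ = N := by
  rw [mem_sphereFaces, support_mem_ballFaces]
  constructor
  · rintro ⟨h, i, hi⟩
    refine le_antisymm h (le_trans ?_ (norm_le_pi_norm x i))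
    rw [Real.norm_eq_abs, le_abs]
    rcases hi with hi | hi
    · right
      have : x i ≤ ((-N : ℤ) : ℝ) := Int.ceil_le.1 (le_of_eq hi)
      push_cast at this
      linarith
    · left
      have : (((N : ℤ) : ℤ) : ℝ) ≤ x i := Int.le_floor.1 (le_of_eq hi.symm)
      exact_mod_cast this
  · intro h
    refine ⟨h.le, ?_⟩
    obtain ⟨i, hi⟩ : ∃ i, (N : ℝ) ≤ ‖x i‖ := by
      by_contra hcon
      push Not at hcon
      exact absurd h ((pi_norm_lt_iff (by exact_mod_cast hN)).2 hcon).ne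
    have h1 : |x i| = N := le_antisymm (h ▸ norm_le_pi_norm x i) hi
    refine ⟨i, ?_⟩
    rcases eq_or_eq_neg_of_abs_eq h1 with h2 | h2
    · right
      change ⌊x i⌋ = N
      rw [h2]; simp
    · left
      change ⌈x i⌉ = -N
      rw [h2, Int.ceil_neg, Int.floor_natCast]

end GridFace

section CarrierExtension

open GridFace

variable {ι : Type*} [Fintype ι] {P : Type*}

/-- Fine enough grid faces have their image in a basic open set. -/
theorem exists_grid_refinement {K : Set (ι → ℝ)} (hK : IsCompact K) {f : (ι → ℝ) → Finset P}
    (hf : ContinuousOn f K) :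
    ∃ N : ℕ, 0 < N ∧ ∀ e : GridFace ι, (∀ x ∈ e.cell, (N : ℝ)⁻¹ • x ∈ K) →
      ∃ x₀ ∈ K, ∀ x ∈ e.cell, f x₀ ⊆ f ((N : ℝ)⁻¹ • x) := by
  have hU : ∀ x₀ : K, ∃ U : Set (ι → ℝ), IsOpen U ∧ x₀.1 ∈ U ∧ ∀ y ∈ U ∩ K, f x₀ ⊆ f y := by
    intro x₀
    obtain ⟨U, hU, hxU, h⟩ := mem_nhdsWithin.1 (continuousOn_finset_iff.1 hf x₀ x₀.2)
    exact ⟨U, hU, hxU, h⟩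
  choose U hUo hxU hfU using hU
  obtain ⟨δ, hδ, hball⟩ := lebesgue_number_lemma_of_metric hK hUo
    (fun x hx => mem_iUnion.2 ⟨⟨x, hx⟩, hxU ⟨x, hx⟩⟩)
  obtain ⟨n, hn⟩ := exists_nat_one_div_lt hδ
  refine ⟨n + 1, n.succ_pos, fun e he => ?_⟩
  obtain ⟨x₀, hx₀⟩ := hball _ (he _ e.lo_mem_cell)
  refine ⟨x₀, x₀.2, fun x hx => hfU x₀ _ ⟨hx₀ ?_, he x hx⟩⟩
  rw [mem_ball, dist_smul₀]
  have h1 := dist_le_of_mem_cell hx e.lo_mem_cell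
  refine lt_of_le_of_lt ?_ hn
  rw [norm_inv, Real.norm_natCast, one_div]
  push_cast
  exact mul_le_of_le_one_right (by positivity) h1

theorem exists_carried_extension {Z : Type*} [TopologicalSpace Z] {K K' : Set (ι → ℝ)}
    (hK : IsCompact K) {f : (ι → ℝ) → Finset P} (hf : ContinuousOn f K) {𝒦 : Set (Finset P)}
    (hne : ∀ c ∈ 𝒦, c.Nonempty) (h𝒦 : ∀ c ∈ 𝒦, ∀ c' ⊆ c, c'.Nonempty → c' ∈ 𝒦)
    (hf𝒦 : MapsTo f K 𝒦) {𝒞 : Finset P → Set Z} (h𝒞 : Antitone 𝒞)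
    (E L : ℕ → Finset (GridFace ι)) (hLE : ∀ N, L N ⊆ E N)
    (hEl : ∀ N, ∀ e ∈ E N, ∀ e' ≤ e, e' ∈ E N) (hLl : ∀ N, ∀ e ∈ L N, ∀ e' ≤ e, e' ∈ L N)
    (hE : ∀ N : ℕ, 0 < N → ∀ x, support x ∈ E N ↔ (N : ℝ)⁻¹ • x ∈ K)
    (hL : ∀ N : ℕ, 0 < N → ∀ x, support x ∈ L N ↔ (N : ℝ)⁻¹ • x ∈ K')
    (hfill : ∀ c ∈ 𝒦, ∀ N, ∀ e ∈ E N, e ∉ L N → FillsSpheres {i // e.lo i < e.hi i} (𝒞 c))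
    {g : (ι → ℝ) → Z} (hg : ContinuousOn g K') (hg𝒞 : ∀ x ∈ K', g x ∈ 𝒞 (f x)) :
    ∃ G : (ι → ℝ) → Z, ContinuousOn G K ∧ EqOn G g K' ∧
      ∀ x ∈ K, ∃ c ∈ 𝒦, c ⊆ f x ∧ G x ∈ 𝒞 c := by
  classical
  obtain ⟨N, hN, hNe⟩ := exists_grid_refinement hK hf
  have hN' : (N : ℝ) ≠ 0 := by positivity
  have hcancel : ∀ x : ι → ℝ, (N : ℝ)⁻¹ • (N : ℝ) • x = x := fun x => inv_smul_smul₀ hN' x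
  let s : GridFace ι → Finset P := fun e =>
    (f ((N : ℝ)⁻¹ • fun i => (e.lo i : ℝ))).filter fun p => ∀ x ∈ e.cell, p ∈ f ((N : ℝ)⁻¹ • x)
  have hs : ∀ e p, p ∈ s e ↔ ∀ x ∈ e.cell, p ∈ f ((N : ℝ)⁻¹ • x) := fun e p => by
    simp only [s, Finset.mem_filter, and_iff_right_iff_imp]
    exact fun h => h _ e.lo_mem_cell
  have hcell : ∀ e ∈ E N, ∀ x ∈ e.cell, (N : ℝ)⁻¹ • x ∈ K := fun e he x hx =>
    (hE N hN x).1 (hEl N e he _ (mem_cell_iff.1 hx))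
  have hsf : ∀ e, ∀ x ∈ e.cell, s e ⊆ f ((N : ℝ)⁻¹ • x) := fun e x hx p hp => (hs e p).1 hp x hx
  have hs𝒦 : ∀ e ∈ E N, s e ∈ 𝒦 := by
    intro e he
    obtain ⟨x₀, hx₀, h⟩ := hNe e (hcell e he)
    refine h𝒦 _ (hf𝒦 (hcell e he _ e.lo_mem_cell)) _ (hsf e _ e.lo_mem_cell) ?_
    obtain ⟨p, hp⟩ := hne _ (hf𝒦 hx₀)
    exact ⟨p, (hs e p).2 fun x hx => h x hx hp⟩
  obtain ⟨G, hG, hGg, hGC⟩ := exists_extension_of_carrier (E N) (hEl N) (fun e => 𝒞 (s e))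
    (fun e e' h => h𝒞 fun p hp => (hs e p).2 fun x hx => (hs e' p).1 hp x (cell_mono h hx))
    (L N) (hLE N) (hLl N) (fun e he heL => hfill _ (hs𝒦 e he) N e he heL)
    (fun x => g ((N : ℝ)⁻¹ • x))
    (hg.comp (by fun_prop) fun x hx => (hL N hN x).1 hx)
    (fun x hx => h𝒞 (hsf _ x (mem_cell_support x)) (hg𝒞 _ ((hL N hN x).1 hx)))
  have hKE : ∀ x ∈ K, support ((N : ℝ) • x) ∈ E N := fun x hx =>
    (hE N hN _).2 (by rwa [hcancel])
  refine ⟨fun x => G ((N : ℝ) • x), hG.comp (by fun_prop) hKE, fun x hx => ?_, fun x hx => ?_⟩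
  · change G ((N : ℝ) • x) = g x
    have h := hGg (show support ((N : ℝ) • x) ∈ L N from (hL N hN _).2 (by rwa [hcancel]))
    simpa only [hcancel] using h
  · refine ⟨_, hs𝒦 _ (hKE x hx), ?_, hGC _ (hKE x hx)⟩
    have := hsf _ _ (mem_cell_support ((N : ℝ) • x))
    rwa [hcancel] at this

theorem norm_inv_natCast_smul {N : ℕ} (x : ι → ℝ) : ‖(N : ℝ)⁻¹ • x‖ = (N : ℝ)⁻¹ * ‖x‖ := by
  rw [norm_smul, norm_inv, Real.norm_natCast]

theorem inv_smul_mem_closedBall {N : ℕ} (hN : 0 < N) (x : ι → ℝ) :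
    (N : ℝ)⁻¹ • x ∈ closedBall (0 : ι → ℝ) 1 ↔ ‖x‖ ≤ N := by
  rw [mem_closedBall_zero_iff, norm_inv_natCast_smul, inv_mul_le_iff₀ (by positivity), mul_one]

theorem inv_smul_mem_sphere {N : ℕ} (hN : 0 < N) (x : ι → ℝ) :
    (N : ℝ)⁻¹ • x ∈ sphere (0 : ι → ℝ) 1 ↔ ‖x‖ = N := by
  rw [mem_sphere_zero_iff_norm, norm_inv_natCast_smul, inv_mul_eq_iff_eq_mul₀ (by positivity),
    mul_one]

/-- A map on the sphere carried by `f` extends to the ball. -/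
theorem exists_carried_extension_ball {Z : Type*} [TopologicalSpace Z]
    {f : (ι → ℝ) → Finset P} (hf : ContinuousOn f (closedBall 0 1)) {𝒦 : Set (Finset P)}
    (hne : ∀ c ∈ 𝒦, c.Nonempty) (h𝒦 : ∀ c ∈ 𝒦, ∀ c' ⊆ c, c'.Nonempty → c' ∈ 𝒦)
    (hf𝒦 : MapsTo f (closedBall 0 1) 𝒦) {𝒞 : Finset P → Set Z} (h𝒞 : Antitone 𝒞)
    (hfill : ∀ c ∈ 𝒦, ∀ k ≤ Fintype.card ι, FillsSpheres (Fin k) (𝒞 c))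
    {g : (ι → ℝ) → Z} (hg : ContinuousOn g (sphere 0 1)) (hg𝒞 : ∀ x ∈ sphere 0 1, g x ∈ 𝒞 (f x)) :
    ∃ G : (ι → ℝ) → Z, ContinuousOn G (closedBall 0 1) ∧ EqOn G g (sphere 0 1) := by
  obtain ⟨G, h1, h2, -⟩ := exists_carried_extension (isCompact_closedBall 0 1) hf hne h𝒦 hf𝒦 h𝒞
    (ballFaces ι) (sphereFaces ι) (fun N e he => (mem_sphereFaces.1 he).1)
    (fun N e he e' h => ballFaces_lower he h) (fun N e he e' h => sphereFaces_lower he h)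
    (fun N hN x => by rw [support_mem_ballFaces, inv_smul_mem_closedBall hN])
    (fun N hN x => by rw [support_mem_sphereFaces hN, inv_smul_mem_sphere hN])
    (fun c hc N e _ _ => (hfill c hc _ (Fintype.card_subtype_le _)).congr_equiv
      (Fintype.equivFin _).symm) hg hg𝒞
  exact ⟨G, h1, h2⟩

/-- Maps on the sphere can be lifted along carriers. -/
theorem exists_carried_map_sphere {Z : Type*} [TopologicalSpace Z] [Nonempty Z]
    {f : (ι → ℝ) → Finset P} (hf : ContinuousOn f (sphere 0 1)) {𝒦 : Set (Finset P)}
    (hne : ∀ c ∈ 𝒦, c.Nonempty) (h𝒦 : ∀ c ∈ 𝒦, ∀ c' ⊆ c, c'.Nonempty → c' ∈ 𝒦)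
    (hf𝒦 : MapsTo f (sphere 0 1) 𝒦) {𝒞 : Finset P → Set Z} (h𝒞 : Antitone 𝒞)
    (hfill : ∀ c ∈ 𝒦, ∀ k < Fintype.card ι, FillsSpheres (Fin k) (𝒞 c)) :
    ∃ G : (ι → ℝ) → Z, ContinuousOn G (sphere 0 1) ∧
      ∀ x ∈ sphere 0 1, ∃ c ∈ 𝒦, c ⊆ f x ∧ G x ∈ 𝒞 c := by
  obtain ⟨G, h1, -, h2⟩ := exists_carried_extension (isCompact_sphere 0 1) hf hne h𝒦 hf𝒦 h𝒞
    (sphereFaces ι) (fun _ => ∅) (K' := ∅) (fun N => Finset.empty_subset _)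
    (fun N e he e' h => sphereFaces_lower he h) (fun N e he => by simp at he)
    (fun N hN x => by rw [support_mem_sphereFaces hN, inv_smul_mem_sphere hN])
    (fun N hN x => by simp)
    (fun c hc N e he _ => (hfill c hc _ (card_lt_of_mem_sphereFaces he)).congr_equiv
      (Fintype.equivFin _).symm) (g := fun _ => Classical.arbitrary Z) continuousOn_const
    (fun x hx => hx.elim)
  exact ⟨G, h1, h2⟩

end CarrierExtension

section Moves

variable {ι : Type*} [Fintype ι] {P Q X : Type*} [TopologicalSpace X]

theorem MonotoneOn.continuousOn_finset {h : Finset P → Finset Q} {𝒮 : Set (Finset P)}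
    (hm : MonotoneOn h 𝒮) : ContinuousOn h 𝒮 := by
  rw [continuousOn_finset_iff]
  intro c hc
  have h1 : ∀ᶠ c' in 𝓝[𝒮] c, c ⊆ c' :=
    mem_nhdsWithin_of_mem_nhds ((isOpen_finset_iff.2 (isUpperSet_Ici c)).mem_nhds self_mem_Ici)
  filter_upwards [h1, self_mem_nhdsWithin] with c' hcc' hc'
  exact hm hc hc' hcc'

theorem ContinuousOn.finset_inter [DecidableEq P] {f g : X → Finset P} {A : Set X}
    (hf : ContinuousOn f A) (hg : ContinuousOn g A) : ContinuousOn (fun x => f x ∩ g x) A := by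
  rw [continuousOn_finset_iff] at *
  intro x hx
  filter_upwards [hf x hx, hg x hx] with y h1 h2
  exact Finset.inter_subset_inter h1 h2

theorem ContinuousOn.finset_union [DecidableEq P] {f g : X → Finset P} {A : Set X}
    (hf : ContinuousOn f A) (hg : ContinuousOn g A) : ContinuousOn (fun x => f x ∪ g x) A := by
  rw [continuousOn_finset_iff] at *
  intro x hx
  filter_upwards [hf x hx, hg x hx] with y h1 h2
  exact Finset.union_subset_union h1 h2

theorem ContinuousOn.finset_filter {f : X → Finset P} {A : Set X} (p : P → Prop)
    [DecidablePred p] (hf : ContinuousOn f A) : ContinuousOn (fun x => (f x).filter p) A := by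
  rw [continuousOn_finset_iff] at *
  intro x hx
  filter_upwards [hf x hx] with y h1
  exact Finset.filter_subset_filter _ h1

variable {𝒮 : Set (Finset P)} {𝒯 : Set (Finset Q)} {g g' : (ι → ℝ) → Finset P}

theorem Fills.of_subset (hf : Fills 𝒮 g') (hg : ContinuousOn g (sphere 0 1))
    (hgS : MapsTo g (sphere 0 1) 𝒮) (hg' : ContinuousOn g' (sphere 0 1))
    (hgS' : MapsTo g' (sphere 0 1) 𝒮) (h : ∀ x ∈ sphere 0 1, g' x ⊆ g x) : Fills 𝒮 g := by
  classical
  let H : ℝ × (ι → ℝ) → Finset P := fun q => if q.1 < 1 then g q.2 else g' q.2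
  refine Fills.of_homotopy H ?_ ?_ ?_ (hf.congr ?_)
  · rw [continuousOn_finset_iff] at *
    rintro ⟨t, x⟩ ⟨ht, hx⟩
    rw [nhdsWithin_prod_eq]
    have h1 := (hg x hx).prod_inr (𝓝[Icc 0 1] t)
    have h2 := (hg' x hx).prod_inr (𝓝[Icc 0 1] t)
    have h3 : ∀ᶠ q in 𝓝[Icc 0 1] t ×ˢ 𝓝[sphere 0 1] x, q.2 ∈ sphere (0 : ι → ℝ) 1 :=
      (eventually_mem_nhdsWithin (a := x) (s := sphere (0 : ι → ℝ) 1)).prod_inr _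
    by_cases ht1 : t < 1
    · have h4 : ∀ᶠ s in 𝓝[Icc 0 1] t, s < 1 :=
        mem_nhdsWithin_of_mem_nhds (Iio_mem_nhds ht1)
      filter_upwards [h1, h4.prod_inl _] with q hq1 hq2
      simpa only [H, if_pos ht1, if_pos hq2] using hq1
    · filter_upwards [h2, h3] with q hq1 hq2
      simp only [H, if_neg ht1]
      split_ifs
      · exact hq1.trans (h _ hq2)
      · exact hq1
  · rintro ⟨t, x⟩ ⟨ht, hx⟩
    simp only [H]
    split_ifs
    exacts [hgS hx, hgS' hx]
  · intro x hx
    simp [H]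
  · intro x hx
    simp [H]

theorem Fills.of_superset (hf : Fills 𝒮 g') (hg : ContinuousOn g (sphere 0 1))
    (hgS : MapsTo g (sphere 0 1) 𝒮) (hg' : ContinuousOn g' (sphere 0 1))
    (hgS' : MapsTo g' (sphere 0 1) 𝒮) (h : ∀ x ∈ sphere 0 1, g x ⊆ g' x) : Fills 𝒮 g := by
  classical
  let H : ℝ × (ι → ℝ) → Finset P := fun q => if 0 < q.1 then g' q.2 else g q.2
  refine Fills.of_homotopy H ?_ ?_ ?_ (hf.congr ?_)
  · rw [continuousOn_finset_iff] at *
    rintro ⟨t, x⟩ ⟨ht, hx⟩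
    rw [nhdsWithin_prod_eq]
    have h1 := (hg x hx).prod_inr (𝓝[Icc 0 1] t)
    have h2 := (hg' x hx).prod_inr (𝓝[Icc 0 1] t)
    have h3 : ∀ᶠ q in 𝓝[Icc 0 1] t ×ˢ 𝓝[sphere 0 1] x, q.2 ∈ sphere (0 : ι → ℝ) 1 :=
      (eventually_mem_nhdsWithin (a := x) (s := sphere (0 : ι → ℝ) 1)).prod_inr _
    by_cases ht1 : 0 < t
    · have h4 : ∀ᶠ s in 𝓝[Icc 0 1] t, 0 < s :=
        mem_nhdsWithin_of_mem_nhds (Ioi_mem_nhds ht1)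
      filter_upwards [h2, h4.prod_inl _] with q hq1 hq2
      simpa only [H, if_pos ht1, if_pos hq2] using hq1
    · filter_upwards [h1, h3] with q hq1 hq2
      simp only [H, if_neg ht1]
      split_ifs
      · exact hq1.trans (h _ hq2)
      · exact hq1
  · rintro ⟨t, x⟩ ⟨ht, hx⟩
    simp only [H]
    split_ifs
    exacts [hgS' hx, hgS hx]
  · intro x hx
    simp [H]
  · intro x hx
    simp [H]

theorem FillsSpheres.of_monotoneOn {a : Finset P → Finset Q} {b : Finset Q → Finset P}
    (hS : FillsSpheres ι 𝒮) (ha : MonotoneOn a 𝒮) (hb : MonotoneOn b 𝒯) (ha' : MapsTo a 𝒮 𝒯)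
    (hb' : MapsTo b 𝒯 𝒮) (h : ∀ c ∈ 𝒯, a (b c) ⊆ c) : FillsSpheres ι 𝒯 := by
  refine ⟨hS.1.elim fun c hc => ⟨a c, ha' hc⟩, fun g hg hgT => ?_⟩
  have hbg : ContinuousOn (b ∘ g) (sphere 0 1) := hb.continuousOn_finset.comp hg hgT
  exact ((hS.2 _ hbg (hb'.comp hgT)).comp ha.continuousOn_finset ha').of_subset hg hgT
    (ha.continuousOn_finset.comp hbg (hb'.comp hgT)) (ha'.comp (hb'.comp hgT))
    fun x hx => h _ (hgT hx)

theorem FillsSpheres.of_isLeast {c : Finset P} (hc : IsLeast 𝒮 c) : FillsSpheres ι 𝒮 :=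
  (fillsSpheres_singleton c).of_monotoneOn (a := id) (b := fun _ => c) monotoneOn_id
    monotoneOn_const (fun _ h => by rw [mem_singleton_iff.1 h]; exact hc.1) (fun _ _ => rfl)
    fun _ h => hc.2 h

end Moves

section Chains

variable {ι : Type*} [Fintype ι] {P Q : Type*} [PartialOrder P] [PartialOrder Q]

/-- The nonempty finite chains in `S`. -/
def chains (S : Set P) : Set (Finset P) := {c | c.Nonempty ∧ ↑c ⊆ S ∧ IsChain (· ≤ ·) (c : Set P)}

theorem chains_mono {S T : Set P} (h : S ⊆ T) : chains S ⊆ chains T :=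
  fun _ hc => ⟨hc.1, hc.2.1.trans h, hc.2.2⟩

theorem chains_lower {S : Set P} {c c' : Finset P} (hc : c ∈ chains S) (h : c' ⊆ c)
    (hne : c'.Nonempty) : c' ∈ chains S :=
  ⟨hne, (Finset.coe_subset.2 h).trans hc.2.1, hc.2.2.mono h⟩

theorem singleton_mem_chains {S : Set P} {p : P} (hp : p ∈ S) : {p} ∈ chains S :=
  ⟨Finset.singleton_nonempty p, by simpa using hp, by simp⟩

/-- A cone fills all spheres. -/
theorem fillsSpheres_chains_of_cone {S : Set P} {m : P} (hm : m ∈ S)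
    (h : ∀ s ∈ S, s ≤ m ∨ m ≤ s) : FillsSpheres ι (chains S) := by
  classical
  refine ⟨⟨_, singleton_mem_chains hm⟩, fun g hg hgS => ?_⟩
  have h1 : ContinuousOn (fun x => {m} ∪ g x) (sphere (0 : ι → ℝ) 1) :=
    continuousOn_const.finset_union hg
  have h2 : MapsTo (fun x => {m} ∪ g x) (sphere (0 : ι → ℝ) 1) (chains S) := by
    intro x hx
    refine ⟨⟨m, by simp⟩, ?_, ?_⟩
    · rw [Finset.coe_union, union_subset_iff]
      exact ⟨by simpa using hm, (hgS hx).2.1⟩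
    · rw [Finset.coe_union, Finset.coe_singleton, singleton_union]
      exact (hgS hx).2.2.insert fun b hb _ => (h b ((hgS hx).2.1 hb)).symm
  exact ((fills_const (singleton_mem_chains hm)).of_subset h1 h2 continuousOn_const
    (fun x _ => singleton_mem_chains hm) fun x _ => Finset.subset_union_left).of_superset hg hgS
    h1 h2 fun x _ => Finset.subset_union_right

/-- Combinatorial `d`-connectedness of a subset of a poset. -/
def ConnectedPoset (d : ℤ) (S : Set P) : Prop :=
  ∀ k : ℕ, (k : ℤ) ≤ d + 1 → FillsSpheres (Fin k) (chains S)

theorem ConnectedPoset.mono {d e : ℤ} {S : Set P} (h : ConnectedPoset d S) (he : e ≤ d) :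
    ConnectedPoset e S :=
  fun k hk => h k (by omega)

/-- The elements of `S` comparable to all elements of `τ`. -/
def linkIn (S : Set P) (τ : Finset P) : Set P := {s ∈ S | ∀ t ∈ τ, s ≤ t ∨ t ≤ s}

/-- Enlarging a `d`-connected subposet by elements with `(d - 1)`-connected links. -/
theorem ConnectedPoset.union {d : ℤ} {S T : Set P} (hS : ConnectedPoset d S)
    (hT : ∀ τ ∈ chains T, ConnectedPoset (d - 1) (linkIn S τ)) : ConnectedPoset d (S ∪ T) := by
  classical
  intro k hk
  obtain ⟨⟨c₀, hc₀⟩, hfill⟩ := hS k hk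
  refine ⟨⟨c₀, chains_mono subset_union_left hc₀⟩, fun g hg hgS => ?_⟩
  let 𝒞 : Finset P → Set (Finset P) := fun c =>
    {c' | c' ∈ chains (S ∪ T) ∧ c ⊆ c' ∧ ∃ p ∈ c', p ∈ S}
  obtain ⟨G, hG, hGc⟩ := exists_carried_map_sphere hg (fun c hc => hc.1)
    (fun c hc c' h h' => chains_lower hc h h') hgS (𝒞 := 𝒞)
    (fun c c' h c'' hc'' => ⟨hc''.1, h.trans hc''.2.1, hc''.2.2⟩) (by
      intro c hc j hj
      rw [Fintype.card_fin] at hj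
      by_cases hcS : ∃ p ∈ c, p ∈ S
      · exact FillsSpheres.of_isLeast (c := c) ⟨⟨hc, subset_rfl, hcS⟩, fun c' hc' => hc'.2.1⟩
      · have hcT : c ∈ chains T := by
          refine ⟨hc.1, fun p hp => ?_, hc.2.2⟩
          exact (hc.2.1 hp).resolve_left fun h => hcS ⟨p, hp, h⟩
        refine (hT c hcT j (by omega)).of_monotoneOn (a := fun t => c ∪ t)
          (b := fun c' => c'.filter (· ∈ S)) ?_ ?_ ?_ ?_ ?_
        · exact fun x _ y _ h => Finset.union_subset_union subset_rfl h
        · exact fun x _ y _ h => Finset.filter_subset_filter _ h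
        · intro t ht
          refine ⟨⟨?_, ?_, ?_⟩, Finset.subset_union_left, ?_⟩
          · exact hc.1.mono Finset.subset_union_left
          · rw [Finset.coe_union, union_subset_iff]
            exact ⟨hc.2.1, fun p hp => Or.inl (ht.2.1 hp).1⟩
          · rw [Finset.coe_union, isChain_union]
            exact ⟨hc.2.2, ht.2.2, fun a ha b hb _ => ((ht.2.1 hb).2 a ha).symm⟩
          · obtain ⟨p, hp⟩ := ht.1
            exact ⟨p, Finset.mem_union_right _ hp, (ht.2.1 hp).1⟩
        · rintro c' ⟨hc', hcc', p, hp, hpS⟩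
          refine ⟨⟨p, by simp [hp, hpS]⟩, fun q hq => ?_, hc'.2.2.mono fun q hq => ?_⟩
          · rw [Finset.mem_coe, Finset.mem_filter] at hq
            exact ⟨hq.2, fun t ht => hc'.2.2.total hq.1 (hcc' ht)⟩
          · exact (Finset.mem_filter.1 hq).1
        · exact fun c' hc' => Finset.union_subset hc'.2.1 (Finset.filter_subset _ _))
  have hGS : MapsTo G (sphere 0 1) (chains (S ∪ T)) := fun x hx => by
    obtain ⟨c, -, -, h⟩ := hGc x hx
    exact h.1
  have hG' : ContinuousOn (fun x => (G x).filter (· ∈ S)) (sphere 0 1) := hG.finset_filter _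
  have hGS' : MapsTo (fun x => (G x).filter (· ∈ S)) (sphere 0 1) (chains S) := fun x hx => by
    obtain ⟨c, -, -, h, -, p, hp, hpS⟩ := hGc x hx
    exact ⟨⟨p, by simp [hp, hpS]⟩, fun q hq => (Finset.mem_filter.1 hq).2,
      h.2.2.mono fun q hq => (Finset.mem_filter.1 hq).1⟩
  have hI : ContinuousOn (fun x => g x ∩ G x) (sphere 0 1) := hg.finset_inter hG
  have hIS : MapsTo (fun x => g x ∩ G x) (sphere 0 1) (chains (S ∪ T)) := fun x hx => by
    obtain ⟨c, hc, hcg, h, hcG, -⟩ := hGc x hx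
    exact chains_lower h Finset.inter_subset_right (hc.1.mono (Finset.subset_inter hcg hcG))
  have hss := chains_mono (S := S) (T := S ∪ T) subset_union_left
  exact ((((hfill _ hG' hGS').mono hss).of_subset hG hGS hG' (hGS'.mono_right hss)
    fun x _ => Finset.filter_subset _ _).of_superset hI hIS hG hGS
    fun x _ => Finset.inter_subset_right).of_subset hg hgS hI hIS
    fun x _ => Finset.inter_subset_left

theorem ConnectedPoset.of_cone {S : Set P} {m : P} (hm : m ∈ S) (h : ∀ s ∈ S, s ≤ m ∨ m ≤ s)
    (d : ℤ) : ConnectedPoset d S :=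
  fun _ _ => fillsSpheres_chains_of_cone hm h

theorem exists_isLeast_of_mem_chains {S : Set P} {τ : Finset P} (hτ : τ ∈ chains S) :
    ∃ m ∈ τ, ∀ t ∈ τ, m ≤ t := by
  obtain ⟨m, hm⟩ := τ.exists_minimal hτ.1
  exact ⟨m, hm.1, fun t ht => (hτ.2.2.total hm.1 ht).elim id fun h => hm.2 ht h⟩

theorem exists_isGreatest_of_mem_chains {S : Set P} {τ : Finset P} (hτ : τ ∈ chains S) :
    ∃ m ∈ τ, ∀ t ∈ τ, t ≤ m := by
  obtain ⟨m, hm⟩ := τ.exists_maximal hτ.1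
  exact ⟨m, hm.1, fun t ht => (hτ.2.2.total ht hm.1).elim id fun h => hm.2 ht h⟩

theorem ConnectedPoset.of_retraction_le {d : ℤ} {S A : Set P} (hS : ConnectedPoset d S)
    (hSA : S ⊆ A) {h : P → P} (hm : MonotoneOn h A) (hAS : MapsTo h A S) (hid : ∀ s ∈ S, h s = s)
    (hle : ∀ a ∈ A, h a ≤ a) : ConnectedPoset d A := by
  rw [← union_eq_self_of_subset_left hSA]
  refine hS.union fun τ hτ => ?_
  obtain ⟨m, hmτ, hmin⟩ := exists_isLeast_of_mem_chains hτ
  have hmA := hτ.2.1 hmτ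
  refine ConnectedPoset.of_cone (S := linkIn S τ) (m := h m)
    ⟨hAS hmA, fun t ht => Or.inl ((hle m hmA).trans (hmin t ht))⟩ (fun s hs => ?_) _
  rcases hs.2 m hmτ with h1 | h1
  · exact Or.inl (hid s hs.1 ▸ hm (hSA hs.1) hmA h1)
  · exact Or.inr ((hle m hmA).trans h1)

theorem ConnectedPoset.of_le_retraction {d : ℤ} {S A : Set P} (hS : ConnectedPoset d S)
    (hSA : S ⊆ A) {h : P → P} (hm : MonotoneOn h A) (hAS : MapsTo h A S) (hid : ∀ s ∈ S, h s = s)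
    (hle : ∀ a ∈ A, a ≤ h a) : ConnectedPoset d A := by
  rw [← union_eq_self_of_subset_left hSA]
  refine hS.union fun τ hτ => ?_
  obtain ⟨m, hmτ, hmax⟩ := exists_isGreatest_of_mem_chains hτ
  have hmA := hτ.2.1 hmτ
  refine ConnectedPoset.of_cone (S := linkIn S τ) (m := h m)
    ⟨hAS hmA, fun t ht => Or.inr ((hmax t ht).trans (hle m hmA))⟩ (fun s hs => ?_) _
  rcases hs.2 m hmτ with h1 | h1
  · exact Or.inl (h1.trans (hle m hmA))
  · exact Or.inr (hid s hs.1 ▸ hm hmA (hSA hs.1) h1)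

theorem ConnectedPoset.iUnion {d : ℤ} {S : ℕ → Set P} (hmono : Monotone S)
    (hS : ∀ n, ConnectedPoset d (S n)) : ConnectedPoset d (⋃ n, S n) := by
  classical
  intro k hk
  refine ⟨(hS 0 k hk).1.mono (chains_mono (subset_iUnion S 0)), fun g hg hgS => ?_⟩
  obtain ⟨n, hn⟩ : ∃ n, ∀ x ∈ sphere (0 : Fin k → ℝ) 1, ∃ p ∈ g x, p ∈ S n := by
    refine (isCompact_sphere (0 : Fin k → ℝ) 1).induction_on
      (p := fun A => ∃ n, ∀ x ∈ A, ∃ p ∈ g x, p ∈ S n) ⟨0, fun _ h => h.elim⟩ ?_ ?_ ?_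
    · rintro A B hAB ⟨n, hn⟩
      exact ⟨n, fun x hx => hn x (hAB hx)⟩
    · rintro A B ⟨n, hn⟩ ⟨m, hm⟩
      refine ⟨max n m, ?_⟩
      rintro x (hx | hx)
      · obtain ⟨p, hp, hp'⟩ := hn x hx
        exact ⟨p, hp, hmono (le_max_left n m) hp'⟩
      · obtain ⟨p, hp, hp'⟩ := hm x hx
        exact ⟨p, hp, hmono (le_max_right n m) hp'⟩
    · intro x hx
      obtain ⟨p, hp⟩ := (hgS hx).1
      obtain ⟨n, hn⟩ := mem_iUnion.1 ((hgS hx).2.1 hp)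
      exact ⟨_, continuousOn_finset_iff.1 hg x hx, n, fun y hy => ⟨p, hy hp, hn⟩⟩
  have hG : ContinuousOn (fun x => (g x).filter (· ∈ S n)) (sphere 0 1) := hg.finset_filter _
  have hGS : MapsTo (fun x => (g x).filter (· ∈ S n)) (sphere 0 1) (chains (S n)) := by
    intro x hx
    obtain ⟨p, hp, hpS⟩ := hn x hx
    exact ⟨⟨p, by simp [hp, hpS]⟩, fun q hq => (Finset.mem_filter.1 hq).2,
      (hgS hx).2.2.mono fun q hq => (Finset.mem_filter.1 hq).1⟩
  have hss := chains_mono (subset_iUnion S n)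
  exact (((hS n k hk).2 _ hG hGS).mono hss).of_subset hg hgS hG (hGS.mono_right hss)
    fun x _ => Finset.filter_subset _ _

theorem connectedPoset_range_iff (φ : P ↪o Q) (d : ℤ) :
    ConnectedPoset d (range φ) ↔ ConnectedPoset d (univ : Set P) := by
  classical
  have h1 : MapsTo (Finset.map φ.toEmbedding) (chains univ) (chains (range φ)) := by
    rintro c ⟨hc, -, hc'⟩
    refine ⟨hc.map, by simp, ?_⟩
    rw [Finset.coe_map]
    rintro _ ⟨a, ha, rfl⟩ _ ⟨b, hb, rfl⟩ -
    simpa using hc'.total ha hb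
  have h2 : MapsTo (fun c : Finset Q => c.preimage φ φ.injective.injOn) (chains (range φ))
      (chains univ) := by
    rintro c ⟨⟨q, hq⟩, hc, hc'⟩
    obtain ⟨p, rfl⟩ := hc hq
    refine ⟨⟨p, by simpa using hq⟩, subset_univ _, ?_⟩
    intro a ha b hb _
    simpa using hc'.total (Finset.mem_preimage.1 ha) (Finset.mem_preimage.1 hb)
  have h3 : Monotone (Finset.map φ.toEmbedding) := fun c c' h => Finset.map_subset_map.2 h
  have h4 : Monotone (fun c : Finset Q => c.preimage φ φ.injective.injOn) := fun c c' h p hp =>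
    Finset.mem_preimage.2 (h (Finset.mem_preimage.1 hp))
  refine forall_congr' fun k => imp_congr_right fun _ => ⟨fun h => ?_, fun h => ?_⟩
  · refine h.of_monotoneOn (h4.monotoneOn _) (h3.monotoneOn _) h2 h1 fun c _ p hp => ?_
    simpa using hp
  · refine h.of_monotoneOn (h3.monotoneOn _) (h4.monotoneOn _) h1 h2 fun c _ p hp => ?_
    obtain ⟨a, ha, rfl⟩ := Finset.mem_map.1 hp
    exact Finset.mem_preimage.1 ha

end Chains

section HomotopyGroups

open unitInterval

variable {n : ℕ} {X : Type*} [TopologicalSpace X]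

theorem norm_eq_max_tail (x : Fin (n + 1) → ℝ) : ‖x‖ = max |x 0| ‖Fin.tail x‖ := by
  refine le_antisymm ?_ ?_
  · refine (pi_norm_le_iff_of_nonneg ((abs_nonneg _).trans (le_max_left _ _))).2 fun i => ?_
    refine Fin.cases (le_max_left _ _) (fun j => ?_) i
    exact (norm_le_pi_norm (Fin.tail x) j).trans (le_max_right _ _)
  · exact max_le (norm_le_pi_norm x 0)
      ((pi_norm_le_iff_of_nonneg (norm_nonneg _)).2 fun j => norm_le_pi_norm x j.succ)

/-- The affine projection from `ℝⁿ` to the unit cube that sends `[-1, 1]ⁿ` onto it. -/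
noncomputable def toCube (y : Fin n → ℝ) : Fin n → I :=
  fun i => projIcc 0 1 zero_le_one ((y i + 1) / 2)

/-- The affine map from the unit cube to `[-1, 1]ⁿ`. -/
def ofCube (y : Fin n → I) : Fin n → ℝ := fun i => 2 * (y i : ℝ) - 1

theorem continuous_toCube : Continuous (toCube : (Fin n → ℝ) → Fin n → I) :=
  continuous_pi fun i => continuous_projIcc.comp (by fun_prop)

theorem continuous_ofCube : Continuous (ofCube : (Fin n → I) → Fin n → ℝ) :=
  continuous_pi fun i => by unfold ofCube; fun_prop

theorem toCube_ofCube (y : Fin n → I) : toCube (ofCube y) = y := by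
  funext i
  have : (2 * (y i : ℝ) - 1 + 1) / 2 = y i := by ring
  rw [toCube, ofCube, this, projIcc_val]

theorem ofCube_toCube {y : Fin n → ℝ} (hy : ‖y‖ ≤ 1) : ofCube (toCube y) = y := by
  funext i
  have h := abs_le.1 ((norm_le_pi_norm y i).trans hy)
  rw [ofCube, toCube, projIcc_of_mem zero_le_one ⟨by linarith, by linarith⟩]
  ring

theorem abs_two_mul_sub_one_le (t : I) : |2 * (t : ℝ) - 1| ≤ 1 :=
  abs_le.2 ⟨by linarith [t.2.1], by linarith [t.2.2]⟩

theorem norm_ofCube_le (y : Fin n → I) : ‖ofCube y‖ ≤ 1 :=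
  (pi_norm_le_iff_of_nonneg zero_le_one).2 fun i => abs_two_mul_sub_one_le (y i)

theorem norm_ofCube_of_mem_boundary {y : Fin n → I} (hy : y ∈ Cube.boundary (Fin n)) :
    ‖ofCube y‖ = 1 := by
  obtain ⟨i, hi⟩ := hy
  refine le_antisymm (norm_ofCube_le y) (le_trans ?_ (norm_le_pi_norm (ofCube y) i))
  rcases hi with hi | hi <;> norm_num [ofCube, hi]

theorem toCube_mem_boundary {y : Fin n → ℝ} (hy : ‖y‖ = 1) : toCube y ∈ Cube.boundary (Fin n) := by
  obtain ⟨i, hi⟩ : ∃ i, 1 ≤ ‖y i‖ := by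
    by_contra hcon
    push Not at hcon
    exact absurd hy ((pi_norm_lt_iff zero_lt_one).2 hcon).ne
  refine ⟨i, ?_⟩
  rcases le_abs.1 hi with h | h
  · right
    exact projIcc_of_right_le _ (by linarith)
  · left
    exact projIcc_of_le_left _ (by linarith)

theorem isClosed_sphere_inter_nonneg :
    IsClosed (sphere (0 : Fin (n + 1) → ℝ) 1 ∩ {x | 0 ≤ x 0}) :=
  isClosed_sphere.inter (isClosed_le continuous_const (continuous_apply 0))

theorem isClosed_sphere_inter_nonpos :
    IsClosed (sphere (0 : Fin (n + 1) → ℝ) 1 ∩ {x | x 0 ≤ 0}) :=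
  isClosed_sphere.inter (isClosed_le (continuous_apply 0) continuous_const)

theorem sphere_eq_union :
    sphere (0 : Fin (n + 1) → ℝ) 1 =
      (sphere 0 1 ∩ {x | 0 ≤ x 0}) ∪ (sphere 0 1 ∩ {x | x 0 ≤ 0}) := by
  ext x
  have := le_total 0 (x 0)
  simp only [mem_union, mem_inter_iff, mem_ofPred_eq]
  tauto

theorem norm_tail_eq_one {x : Fin (n + 1) → ℝ} (hx : x ∈ sphere (0 : Fin (n + 1) → ℝ) 1)
    (h : |x 0| < 1) : ‖Fin.tail x‖ = 1 := by
  rw [mem_sphere_zero_iff_norm, norm_eq_max_tail] at hx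
  rcases max_choice |x 0| ‖Fin.tail x‖ with h' | h'
  · linarith
  · rw [← h', hx]

theorem subsingleton_homotopyGroup (h : FillsSpheres (Fin (n + 1)) (univ : Set X)) (p : X) :
    Subsingleton (HomotopyGroup (Fin n) X p) := by
  refine ⟨fun f g => Quotient.inductionOn₂ f g fun f g => Quotient.sound ?_⟩
  let γ : (Fin (n + 1) → ℝ) → X := fun x =>
    if x 0 ≤ 0 then f (toCube (Fin.tail x)) else g (toCube (Fin.tail x))
  have hf : ∀ x : Fin (n + 1) → ℝ, ‖Fin.tail x‖ = 1 → f (toCube (Fin.tail x)) = p :=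
    fun x hx => f.2 _ (toCube_mem_boundary hx)
  have hg : ∀ x : Fin (n + 1) → ℝ, ‖Fin.tail x‖ = 1 → g (toCube (Fin.tail x)) = p :=
    fun x hx => g.2 _ (toCube_mem_boundary hx)
  have htail : Continuous fun x : Fin (n + 1) → ℝ => toCube (Fin.tail x) :=
    continuous_toCube.comp (by unfold Fin.tail; fun_prop)
  have hγ : ContinuousOn γ (sphere 0 1) := by
    rw [sphere_eq_union]
    refine ContinuousOn.union_of_isClosed ?_ ?_ isClosed_sphere_inter_nonneg
      isClosed_sphere_inter_nonpos
    · refine ContinuousOn.congr ((g.1.continuous.comp htail).continuousOn) fun x hx => ?_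
      have h0 : 0 ≤ x 0 := hx.2
      rcases h0.eq_or_lt with h0 | h0
      · have : ‖Fin.tail x‖ = 1 := norm_tail_eq_one hx.1 (by rw [← h0]; simp)
        simp only [γ, ← h0, le_refl, if_true]
        exact (hf x this).trans (hg x this).symm
      · exact if_neg (not_le.2 h0)
    · exact ContinuousOn.congr ((f.1.continuous.comp htail).continuousOn) fun x hx => if_pos hx.2
  obtain ⟨G, hG, hGγ, -⟩ := h.2 γ hγ (mapsTo_univ _ _)
  let c : I × (Fin n → I) → Fin (n + 1) → ℝ := fun q => Fin.cons (2 * (q.1 : ℝ) - 1) (ofCube q.2)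
  have hc : Continuous c :=
    Continuous.finCons (by fun_prop) (continuous_ofCube.comp continuous_snd)
  have hc0 : ∀ q, c q 0 = 2 * (q.1 : ℝ) - 1 := fun q => rfl
  have hct : ∀ q, Fin.tail (c q) = ofCube q.2 := fun q => rfl
  have hcb : ∀ q, c q ∈ closedBall (0 : Fin (n + 1) → ℝ) 1 := fun q => by
    rw [mem_closedBall_zero_iff, norm_eq_max_tail, hc0, hct]
    exact max_le (abs_two_mul_sub_one_le q.1) (norm_ofCube_le q.2)
  have hcs : ∀ q, (|2 * (q.1 : ℝ) - 1| = 1 ∨ ‖ofCube q.2‖ = 1) → G (c q) = γ (c q) := fun q hq => by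
    refine hGγ (mem_sphere_zero_iff_norm.2 ?_)
    rw [norm_eq_max_tail, hc0, hct]
    rcases hq with hq | hq
    · rw [hq, max_eq_left (norm_ofCube_le _)]
    · rw [hq, max_eq_right (abs_two_mul_sub_one_le _)]
  refine ⟨⟨⟨⟨fun q => G (c q), hG.comp_continuous hc hcb⟩, fun y => ?_, fun y => ?_⟩,
    fun t y hy => ?_⟩⟩
  · change G (c (0, y)) = f y
    rw [hcs _ (Or.inl (by norm_num))]
    simp only [γ, hc0, hct, toCube_ofCube]
    norm_num
  · change G (c (1, y)) = g y
    rw [hcs _ (Or.inl (by norm_num))]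
    simp only [γ, hc0, hct, toCube_ofCube]
    norm_num
  · change G (c (t, y)) = f y
    rw [hcs _ (Or.inr (norm_ofCube_of_mem_boundary hy))]
    simp only [γ, hct, toCube_ofCube]
    rw [GenLoop.boundary f y hy, GenLoop.boundary g y hy, ite_self]

/-- A homotopy from the identity of the sphere to a map collapsing all faces of the cube but one. -/
noncomputable def collapseVector (q : ℝ × (Fin (n + 1) → ℝ)) : Fin (n + 1) → ℝ :=
  Fin.cons (q.2 0 - 2 * q.1 * ‖Fin.tail q.2‖)
    (((1 - q.1) + q.1 * ((1 - ‖Fin.tail q.2‖) * (1 + q.2 0))) • Fin.tail q.2)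

theorem continuous_collapseVector :
    Continuous (collapseVector : ℝ × (Fin (n + 1) → ℝ) → Fin (n + 1) → ℝ) := by
  have htail : Continuous fun q : ℝ × (Fin (n + 1) → ℝ) => Fin.tail q.2 := by
    unfold Fin.tail
    fun_prop
  exact Continuous.finCons (by fun_prop) (by fun_prop)

theorem collapseVector_ne_zero {t : ℝ} (ht : t ∈ Icc (0 : ℝ) 1) {x : Fin (n + 1) → ℝ}
    (hx : x ∈ sphere (0 : Fin (n + 1) → ℝ) 1) : collapseVector (t, x) ≠ 0 := by
  intro h
  have h0 : x 0 - 2 * t * ‖Fin.tail x‖ = 0 := congrFun h 0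
  have h1 : ((1 - t) + t * ((1 - ‖Fin.tail x‖) * (1 + x 0))) • Fin.tail x = 0 :=
    funext fun i => congrFun h i.succ
  rw [mem_sphere_zero_iff_norm, norm_eq_max_tail] at hx
  have hx0 : |x 0| ≤ 1 := hx ▸ le_max_left _ _
  have hxt : ‖Fin.tail x‖ ≤ 1 := hx ▸ le_max_right _ _
  have hn := norm_nonneg (Fin.tail x)
  obtain ⟨ht0, ht1⟩ := ht
  rcases smul_eq_zero.1 h1 with h2 | h2
  · have hp : 0 ≤ x 0 := by nlinarith [mul_nonneg ht0 hn]
    have h3 : 0 ≤ (1 - ‖Fin.tail x‖) * (1 + x 0) := mul_nonneg (by linarith) (by linarith)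
    have h4 : t = 1 := by nlinarith [mul_nonneg ht0 h3]
    subst h4
    have h5 : (1 - ‖Fin.tail x‖) * (1 + x 0) = 0 := by linarith
    rcases mul_eq_zero.1 h5 with h6 | h6
    · have := (abs_le.1 hx0).2
      linarith
    · linarith
  · rw [h2, norm_zero] at h0 hx
    have : x 0 = 0 := by linarith
    rw [this] at hx
    simp at hx

theorem fillsSpheres_succ {p₀ : X} (h : ∀ p : X, Subsingleton (HomotopyGroup (Fin n) X p)) :
    FillsSpheres (Fin (n + 1)) (univ : Set X) := by
  refine ⟨⟨p₀, mem_univ _⟩, fun g hg _ => ?_⟩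
  let v : ℝ × (Fin (n + 1) → ℝ) → Fin (n + 1) → ℝ := collapseVector
  let r : ℝ × (Fin (n + 1) → ℝ) → Fin (n + 1) → ℝ := fun q => ‖v q‖⁻¹ • v q
  have hr : ContinuousOn r (Icc 0 1 ×ˢ sphere 0 1) := by
    refine ContinuousOn.smul (ContinuousOn.inv₀ continuous_collapseVector.norm.continuousOn ?_)
      continuous_collapseVector.continuousOn
    exact fun q hq => norm_ne_zero_iff.2 (collapseVector_ne_zero hq.1 hq.2)
  have hrs : MapsTo r (Icc 0 1 ×ˢ sphere 0 1) (sphere 0 1) := by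
    intro q hq
    have := norm_ne_zero_iff.2 (collapseVector_ne_zero hq.1 hq.2)
    rw [mem_sphere_zero_iff_norm, norm_smul, norm_inv, norm_norm]
    exact inv_mul_cancel₀ this
  have hv0 : ∀ x, v (0, x) = x := fun x => by
    simp [v, collapseVector]
  refine Fills.of_homotopy (fun q => g (r q)) (hg.comp hr hrs) (mapsTo_univ _ _) ?_ ?_
  · intro x hx
    simp only [r, hv0, mem_sphere_zero_iff_norm.1 hx]
    simp
  set e : Fin (n + 1) → ℝ := Fin.cons (-1) 0
  set p := g e
  have hcol : ∀ x ∈ sphere (0 : Fin (n + 1) → ℝ) 1, (x 0 = -1 ∨ ‖Fin.tail x‖ = 1) →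
      r (1, x) = e := by
    intro x hx h
    have hx1 := hx
    rw [mem_sphere_zero_iff_norm, norm_eq_max_tail] at hx1
    have hx0 : |x 0| ≤ 1 := hx1 ▸ le_max_left _ _
    have hn := norm_nonneg (Fin.tail x)
    obtain ⟨a, ha, hva⟩ : ∃ a : ℝ, 0 < a ∧ v (1, x) = a • e := by
      refine ⟨2 * ‖Fin.tail x‖ - x 0, ?_, ?_⟩
      · have := (abs_le.1 hx0).2
        rcases h with h | h <;> rw [h] <;> linarith
      · have h3 : (1 - ‖Fin.tail x‖) * (1 + x 0) = 0 := by
          rcases h with h | h <;> rw [h] <;> ring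
        funext i
        refine Fin.cases ?_ (fun j => ?_) i
        · simp [v, collapseVector, e]
        · simp [v, collapseVector, e, h3]
    have he : ‖e‖ = 1 := by
      rw [norm_eq_max_tail]
      simp [e]
    simp only [r, hva]
    rw [norm_smul, he, mul_one, Real.norm_of_nonneg ha.le, inv_smul_smul₀ ha.ne']
  have htop : ∀ y : Fin n → I, (Fin.cons 1 (ofCube y) : Fin (n + 1) → ℝ) ∈ sphere 0 1 := by
    intro y
    rw [mem_sphere_zero_iff_norm, norm_eq_max_tail, Fin.tail_cons, Fin.cons_zero, abs_one]
    exact max_eq_left (norm_ofCube_le y)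
  have hr1 : ContinuousOn (fun x => g (r (1, x))) (sphere 0 1) :=
    (hg.comp hr hrs).comp (by fun_prop) fun x hx => ⟨by simp, hx⟩
  let φ : GenLoop (Fin n) X p := ⟨⟨fun y => g (r (1, Fin.cons 1 (ofCube y))),
    hr1.comp_continuous (Continuous.finCons continuous_const continuous_ofCube) htop⟩,
    fun y hy => congrArg g (hcol _ (htop y)
      (Or.inr (by rw [Fin.tail_cons]; exact norm_ofCube_of_mem_boundary hy)))⟩
  have hφ : GenLoop.Homotopic φ GenLoop.const := by
    have := h p
    exact Quotient.exact (Subsingleton.elim (α := HomotopyGroup (Fin n) X p) ⟦φ⟧ ⟦GenLoop.const⟧)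
  obtain ⟨K⟩ := hφ
  let k : ℝ × (Fin (n + 1) → ℝ) → X := fun q =>
    K (projIcc 0 1 zero_le_one q.1, toCube (Fin.tail q.2))
  have hk : Continuous k := by
    refine K.continuous.comp ((continuous_projIcc.comp continuous_fst).prodMk ?_)
    exact continuous_toCube.comp (by unfold Fin.tail; fun_prop)
  have hkp : ∀ q : ℝ × (Fin (n + 1) → ℝ), ‖Fin.tail q.2‖ = 1 → k q = p := fun q hq => by
    have hb := toCube_mem_boundary hq
    exact (K.prop (projIcc 0 1 zero_le_one q.1) _ hb).trans (φ.2 _ hb)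
  let L : ℝ × (Fin (n + 1) → ℝ) → X := fun q => if 0 ≤ q.2 0 then k q else p
  refine Fills.of_homotopy L ?_ (mapsTo_univ _ _) ?_ ?_
  · have hset : (Icc 0 1 : Set ℝ) ×ˢ sphere (0 : Fin (n + 1) → ℝ) 1 =
        (Icc 0 1 ×ˢ (sphere 0 1 ∩ {x | 0 ≤ x 0})) ∪ (Icc 0 1 ×ˢ (sphere 0 1 ∩ {x | x 0 ≤ 0})) := by
      rw [← prod_union, ← sphere_eq_union]
    rw [hset]
    refine ContinuousOn.union_of_isClosed ?_ ?_ (isClosed_Icc.prod isClosed_sphere_inter_nonneg)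
      (isClosed_Icc.prod isClosed_sphere_inter_nonpos)
    · exact hk.continuousOn.congr fun q hq => if_pos hq.2.2
    · refine (continuousOn_const (c := p)).congr fun q hq => ?_
      have h0 : q.2 0 ≤ 0 := hq.2.2
      rcases h0.eq_or_lt with h0 | h0
      · rw [← hkp q (norm_tail_eq_one hq.2.1 (by rw [h0]; simp))]
        exact if_pos h0.ge
      · exact if_neg (not_le.2 h0)
  · intro x hx
    have hx1 := hx
    rw [mem_sphere_zero_iff_norm, norm_eq_max_tail] at hx1
    have hx0 : |x 0| ≤ 1 := hx1 ▸ le_max_left _ _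
    have hxt : ‖Fin.tail x‖ ≤ 1 := hx1 ▸ le_max_right _ _
    by_cases hJ : x 0 = -1 ∨ ‖Fin.tail x‖ = 1
    · rw [hcol x hx hJ]
      rcases hJ with hJ | hJ
      · exact if_neg (by simp only [hJ]; norm_num)
      · simp only [L, hkp (0, x) hJ, ite_self]
        rfl
    · push Not at hJ
      have hx01 : x 0 = 1 := by
        by_contra hne
        refine hJ.2 (norm_tail_eq_one hx (lt_of_le_of_ne hx0 fun h => ?_))
        rcases eq_or_eq_neg_of_abs_eq h with h | h
        exacts [hne h, hJ.1 h]
      have hL : L (0, x) = k (0, x) := if_pos (by simp only [hx01]; norm_num)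
      rw [hL]
      have h0 : projIcc (0 : ℝ) 1 zero_le_one 0 = 0 := projIcc_left _
      have hxc : (Fin.cons 1 (ofCube (toCube (Fin.tail x))) : Fin (n + 1) → ℝ) = x := by
        rw [ofCube_toCube hxt, ← hx01, Fin.cons_self_tail]
      simp only [k, h0]
      refine (K.apply_zero _).trans ?_
      change g (r (1, _)) = _
      rw [hxc]
  · refine (fills_const (mem_univ p)).congr fun x hx => ?_
    have h1 : projIcc (0 : ℝ) 1 zero_le_one 1 = 1 := projIcc_right _
    have hk1 : k (1, x) = p := by
      simp only [k, h1]
      exact K.apply_one _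
    simp only [L, hk1, ite_self]

theorem topDConnected_iff (d : ℤ) :
    TopDConnected X d ↔ ∀ k : ℕ, (k : ℤ) ≤ d + 1 → FillsSpheres (Fin k) (univ : Set X) := by
  constructor
  · rintro (h | ⟨⟨p⟩, h⟩) k hk
    · omega
    · cases k with
      | zero =>
        refine ⟨⟨p, mem_univ _⟩, fun g _ _ => ⟨fun _ => p, continuousOn_const, fun x hx => ?_,
          mapsTo_univ _ _⟩⟩
        rw [mem_sphere_zero_iff_norm, Subsingleton.elim x 0, norm_zero] at hx
        exact absurd hx zero_ne_one
      | succ n => exact fillsSpheres_succ (p₀ := p) (h n (by push_cast at hk; omega))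
  · intro h
    by_cases hd : d ≤ -2
    · exact Or.inl hd
    · obtain ⟨p, -⟩ := (h 0 (by push_cast; omega)).1
      exact Or.inr ⟨⟨p⟩, fun n hn => subsingleton_homotopyGroup (h (n + 1) (by push_cast; omega))⟩

end HomotopyGroups

namespace OSeq

variable {V : Type*}

theorem le_iff {z w : OSeq V} : z ≤ w ↔ z.1.Sublist w.1 := Iff.rfl

theorem eq_of_le_of_length_le {z w : OSeq V} (h : z ≤ w) (hl : w.1.length ≤ z.1.length) : z = w :=
  Subtype.ext (h.eq_of_length_le hl)

theorem length_lt_of_lt {z w : OSeq V} (h : z < w) : z.1.length < w.1.length := by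
  by_contra hl
  exact h.ne (eq_of_le_of_length_le h.le (not_lt.1 hl))

theorem subset_of_le {z w : OSeq V} (h : z ≤ w) : z.1 ⊆ w.1 := List.Sublist.subset h

/-- The sequence with entries `l`. -/
def mk (l : List V) (h : l ≠ []) (h' : l.Nodup) : OSeq V := ⟨l, h, h'⟩

theorem mk_val (l : List V) (h : l ≠ []) (h' : l.Nodup) : (mk l h h').1 = l := rfl

open Classical in
/-- The list `l` if it is a valid sequence, and `z` otherwise. -/
noncomputable def ofList (l : List V) (z : OSeq V) : OSeq V :=
  if h : l ≠ [] ∧ l.Nodup then mk l h.1 h.2 else z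

theorem ofList_val {l : List V} (z : OSeq V) (h : l ≠ []) (h' : l.Nodup) :
    (ofList l z).1 = l := by
  rw [ofList, dif_pos ⟨h, h'⟩, mk_val]

/-- The proper faces of `u` that are not obtained by dropping its first entry, together with a
set of sequences above `u`, form a contractible poset. -/
theorem connectedPoset_horn {v : OSeq V} {a : V} {u : List V} (hv : v.1 = a :: u) (hu : u ≠ [])
    {Q : Set (OSeq V)} (hQ : ∀ q ∈ Q, v < q) (d : ℤ) :
    ConnectedPoset d ({z : OSeq V | z < v ∧ z.1 ≠ u} ∪ Q) := by
  classical
  set A : Set (OSeq V) := {z : OSeq V | z < v ∧ z.1 ≠ u} ∪ Q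
  have hau : (a :: u).Nodup := hv ▸ v.2.2
  have hle : ∀ {z : OSeq V}, z ≤ v → z.1.Sublist (a :: u) := fun h => hv ▸ le_iff.1 h
  have hau' : a ∉ u := (List.nodup_cons.1 hau).1
  have hQa : ∀ q ∈ Q, a ∈ q.1 := fun q hq => subset_of_le (hQ q hq).le (by simp [hv])
  have hsub : ∀ z ∈ A, a ∉ z.1 → z.1.Sublist u ∧ z.1 ≠ u := by
    rintro z (hz | hz) haz
    · exact ⟨(List.sublist_cons_iff.1 (hle hz.1.le)).resolve_right
        (by rintro ⟨r, hr, -⟩; exact haz (by simp [hr])), hz.2⟩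
    · exact absurd (hQa z hz) haz
  let h : OSeq V → OSeq V := fun z => if a ∈ z.1 then z else ofList (a :: z.1) z
  have hpos : ∀ z, a ∈ z.1 → h z = z := fun z hz => if_pos hz
  have hneg : ∀ z, a ∉ z.1 → (h z).1 = a :: z.1 := fun z hz => by
    simp only [h, if_neg hz]
    exact ofList_val z (by simp) (List.nodup_cons.2 ⟨hz, z.2.2⟩)
  have hmem : ∀ z, a ∈ (h z).1 := fun z => by
    by_cases hz : a ∈ z.1
    · rwa [hpos z hz]
    · simp [hneg z hz]
  have hcone : ConnectedPoset d {z ∈ A | a ∈ z.1} := by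
    have hav : mk [a] (by simp) (by simp) ≤ v := by
      rw [le_iff, hv, mk_val]
      simp
    refine ConnectedPoset.of_cone (S := {z ∈ A | a ∈ z.1}) (m := mk [a] (by simp) (by simp)) ⟨Or.inl ⟨?_, ?_⟩, ?_⟩
      (fun s hs => Or.inr ?_) d
    · refine lt_of_le_of_ne hav fun h => hu ?_
      have h' := congrArg Subtype.val h
      rw [hv, mk_val] at h'
      simpa using h'.symm
    · rw [mk_val]
      rintro rfl
      simp at hau'
    · simp [mk_val]
    · rw [le_iff, mk_val]
      simpa using hs.2
  refine hcone.of_le_retraction (fun z hz => hz.1) (h := h) ?_ ?_ (fun z hz => hpos z hz.2) ?_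
  · intro z hz z' hz' hzz'
    by_cases h1 : a ∈ z.1
    · rw [hpos z h1, hpos z' (subset_of_le hzz' h1)]
      exact hzz'
    · rw [le_iff, hneg z h1]
      by_cases h2 : a ∈ z'.1
      · rw [hpos z' h2]
        rcases hz' with hz' | hz'
        · rcases List.sublist_cons_iff.1 (hle hz'.1.le) with h3 | ⟨r, hr, h3⟩
          · exact absurd (h3.subset h2) hau'
          · rw [hr]
            have h4 : z.1.Sublist (a :: r) := hr ▸ hzz'
            refine ((List.sublist_cons_iff.1 h4).resolve_right ?_).cons_cons a
            rintro ⟨r', hr', -⟩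
            exact h1 (by simp [hr'])
        · exact ((hsub z hz h1).1.cons_cons a).trans (hv ▸ le_iff.1 (hQ z' hz').le)
      · rw [hneg z' h2]
        exact List.Sublist.cons_cons a hzz'
  · intro z hz
    refine ⟨?_, hmem z⟩
    by_cases h1 : a ∈ z.1
    · rwa [hpos z h1]
    · obtain ⟨h2, h3⟩ := hsub z hz h1
      have h4 := hneg z h1
      refine Or.inl ⟨lt_of_le_of_ne ?_ ?_, ?_⟩
      · rw [le_iff, h4, hv]
        exact h2.cons_cons a
      · intro h5
        rw [h5, hv] at h4
        exact h3 (List.cons_injective h4).symm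
      · intro h5
        exact hau' (h5 ▸ hmem z)
  · intro z hz
    by_cases h1 : a ∈ z.1
    · rw [hpos z h1]
    · rw [le_iff, hneg z h1]
      exact List.sublist_cons_self a z.1

/-- The proper faces of `u` together with a `c`-connected set of sequences above `u` form the join
of a sphere of dimension `|u| - 2` with a `c`-connected poset. -/
theorem connectedPoset_join (v : OSeq V) {Q : Set (OSeq V)} (hQ : ∀ q ∈ Q, v < q) {c : ℤ}
    (hc : ConnectedPoset c Q) :
    ConnectedPoset (c + v.1.length - 1) ({z : OSeq V | z < v} ∪ Q) := by
  obtain ⟨u, hu⟩ : ∃ u, v.1 = u := ⟨_, rfl⟩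
  induction u generalizing v with
  | nil => exact absurd hu v.2.1
  | cons a u ih =>
    by_cases hne : u = []
    · subst hne
      have : {z : OSeq V | z < v} = ∅ := by
        refine eq_empty_of_forall_notMem fun z hz => z.2.1 ?_
        have := length_lt_of_lt hz
        simpa [hu] using this
      rw [this, empty_union]
      simpa [hu] using hc
    · have hnd := v.2.2
      rw [hu] at hnd
      let w : OSeq V := mk u hne (List.nodup_cons.1 hnd).2
      have hw : w.1 = u := rfl
      have hwv : w < v := by
        refine lt_of_le_of_ne (by rw [le_iff, hu]; exact List.sublist_cons_self a u) fun h => ?_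
        have := congrArg (fun z : OSeq V => z.1.length) h
        simp [hw, hu] at this
      have hT : {z : OSeq V | z < v} ∪ Q = ({z : OSeq V | z < v ∧ z.1 ≠ u} ∪ Q) ∪ {w} := by
        ext z
        simp only [mem_union, mem_ofPred_eq, mem_singleton_iff]
        constructor
        · rintro (h | h)
          · by_cases hz : z.1 = u
            · exact Or.inr (Subtype.ext hz)
            · exact Or.inl (Or.inl ⟨h, hz⟩)
          · exact Or.inl (Or.inr h)
        · rintro ((h | h) | rfl)
          exacts [Or.inl h.1, Or.inr h, Or.inl hwv]
      rw [hT]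
      refine (connectedPoset_horn hu hne hQ _).union fun τ hτ => ?_
      obtain rfl : τ = {w} :=
        Finset.eq_singleton_iff_nonempty_unique_mem.2 ⟨hτ.1, fun t ht => hτ.2.1 ht⟩
      have hlink : linkIn ({z : OSeq V | z < v ∧ z.1 ≠ u} ∪ Q) {w} =
          {z : OSeq V | z < w} ∪ Q := by
        ext z
        simp only [linkIn, mem_union, mem_ofPred_eq, Finset.mem_singleton, forall_eq]
        constructor
        · rintro ⟨h | h, h'⟩
          · have hzw : z ≠ w := fun e => h.2 (congrArg Subtype.val e)
            rcases h' with h' | h'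
            · exact Or.inl (lt_of_le_of_ne h' hzw)
            · have := length_lt_of_lt h.1
              refine absurd (eq_of_le_of_length_le h' ?_).symm hzw
              rw [hu, List.length_cons] at this
              exact Nat.lt_succ_iff.1 this
          · exact Or.inr h
        · rintro (h | h)
          · exact ⟨Or.inl ⟨h.trans hwv, fun e => h.ne (Subtype.ext e)⟩, Or.inl h.le⟩
          · exact ⟨Or.inr h, Or.inr (hwv.trans (hQ z h)).le⟩
      rw [hlink]
      refine (ih w (fun q hq => hwv.trans (hQ q hq)) hw).mono ?_
      rw [hu, hw, List.length_cons]
      push_cast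
      omega

end OSeq

section ChainLemma

variable {V : Type*} {F : Set (OSeq V)} {X : Set V} {d : ℤ}

open OSeq

theorem connectedPoset_head_mem (hchain : ChainCondition F)
    (h1 : ConnectedPoset d (SeqIn X ∩ F)) :
    ConnectedPoset d {z ∈ F | z.1.head z.2.1 ∈ X} := by
  classical
  let h : OSeq V → OSeq V := fun z => ofList (z.1.filter (· ∈ X)) z
  have hval : ∀ z : OSeq V, z.1.head z.2.1 ∈ X → (h z).1 = z.1.filter (· ∈ X) := fun z hz =>
    ofList_val z (List.ne_nil_of_mem (List.mem_filter.2 ⟨List.head_mem z.2.1, by simpa using hz⟩))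
      (z.2.2.filter _)
  have hle : ∀ z : OSeq V, z.1.head z.2.1 ∈ X → h z ≤ z := fun z hz => by
    rw [le_iff, hval z hz]
    exact List.filter_sublist
  refine h1.of_retraction_le (h := h) ?_ ?_ ?_ ?_ ?_
  · exact fun z hz => ⟨hz.2, hz.1 _ (List.head_mem z.2.1)⟩
  · intro z hz z' hz' hzz'
    rw [le_iff, hval z hz.2, hval z' hz'.2]
    exact hzz'.filter _
  · refine fun z hz => ⟨fun x hx => ?_, hchain (hle z hz.2) hz.1⟩
    rw [hval z hz.2] at hx
    simpa using (List.mem_filter.1 hx).2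
  · intro z hz
    refine Subtype.ext ?_
    rw [hval z (hz.1 _ (List.head_mem z.2.1)), List.filter_eq_self]
    exact fun x hx => by simpa using hz.1 x hx
  · exact fun z hz => hle z hz.2

theorem exists_eq_append_of_le {u z : OSeq V} (h : u ≤ z) :
    ∃ w r : List V, z.1 = w ++ u.1.head u.2.1 :: r ∧ u.1.Sublist (u.1.head u.2.1 :: r) ∧
      u.1.head u.2.1 ∉ w := by
  obtain ⟨w, r, hz⟩ := List.append_of_mem (subset_of_le h (List.head_mem u.2.1))
  have hnd := z.2.2
  rw [hz, List.nodup_append] at hnd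
  have hw : u.1.head u.2.1 ∉ w := fun hm => hnd.2.2 _ hm _ (by simp) rfl
  refine ⟨w, r, hz, ?_, hw⟩
  obtain ⟨l₁, l₂, h1, h2, h3⟩ := List.sublist_append_iff.1 (hz ▸ le_iff.1 h)
  cases l₁ with
  | nil =>
    rw [List.nil_append] at h1
    rwa [← h1] at h3
  | cons b l =>
    refine absurd (h2.subset ?_) hw
    simp [h1]

theorem takeWhile_append_cons {p : V → Bool} {w r : List V} {a : V} (hw : ∀ b ∈ w, p b)
    (ha : ¬p a) : (w ++ a :: r).takeWhile p = w := by
  rw [List.takeWhile_append_of_pos hw, List.takeWhile_cons_of_neg ha, List.append_nil]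

theorem connectedPoset_above (hchain : ChainCondition F) {u : OSeq V} (hu : u.1.head u.2.1 ∉ X)
    (h2 : ConnectedPoset d (univ : Set ↥(SeqIn X ∩ SeqExt F u))) :
    ConnectedPoset d {z ∈ F | z.1.head z.2.1 ∈ X ∧ u < z} := by
  classical
  set a := u.1.head u.2.1
  have hau : a ∈ u.1 := List.head_mem u.2.1
  let l : OSeq V → List V := fun z => (z.1.takeWhile (· ≠ a)).filter (· ∈ X)
  let h : OSeq V → OSeq V := fun z => ofList (l z ++ u.1) z
  have key : ∀ z : OSeq V, u ≤ z → ∃ w r : List V, z.1 = w ++ a :: r ∧ u.1.Sublist (a :: r) ∧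
      a ∉ w ∧ l z = w.filter (· ∈ X) := by
    intro z hz
    obtain ⟨w, r, h1, h2, h3⟩ := exists_eq_append_of_le hz
    refine ⟨w, r, h1, h2, h3, ?_⟩
    simp only [l, h1]
    rw [takeWhile_append_cons _ (by simp [a])]
    intro b hb
    have : b ≠ a := by
      rintro rfl
      exact h3 hb
    simpa using this
  have hsub : ∀ z : OSeq V, u ≤ z → (l z ++ u.1).Sublist z.1 := by
    intro z hz
    obtain ⟨w, r, h1, h2, h3, h4⟩ := key z hz
    rw [h4, h1]
    exact List.filter_sublist.append h2
  have hval : ∀ z : OSeq V, u ≤ z → (h z).1 = l z ++ u.1 := fun z hz =>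
    ofList_val z (by simp [u.2.1]) (z.2.2.sublist (hsub z hz))
  have hle : ∀ z : OSeq V, u ≤ z → h z ≤ z := fun z hz => by
    rw [le_iff, hval z hz]
    exact hsub z hz
  have hlX : ∀ z, ∀ x ∈ l z, x ∈ X := fun z x hx => by
    simpa using (List.mem_filter.1 hx).2
  have hlne : ∀ z : OSeq V, z.1.head z.2.1 ∈ X → u ≤ z → l z ≠ [] := by
    intro z hzX hz
    obtain ⟨w, r, h1, h2, h3, h4⟩ := key z hz
    cases w with
    | nil =>
      simp only [h1, List.nil_append, List.head_cons] at hzX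
      exact absurd hzX hu
    | cons b w =>
      simp only [h1, List.cons_append, List.head_cons] at hzX
      rw [h4]
      exact List.ne_nil_of_mem (List.mem_filter.2 ⟨List.mem_cons_self, by simpa using hzX⟩)
  let φ : ↥(SeqIn X ∩ SeqExt F u) ↪o OSeq V := OrderEmbedding.ofMapLEIff
    (fun w => mk (w.1.1 ++ u.1) w.2.2.2.1.1 w.2.2.2.1.2) fun w w' =>
      List.append_sublist_append_right u.1
  have hφval : ∀ w, (φ w).1 = w.1.1 ++ u.1 := fun w => rfl
  have hφF : ∀ w, φ w ∈ F := fun w => w.2.2.2.2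
  have hφu : ∀ w, u < φ w := fun w => by
    refine lt_of_le_of_ne (by rw [le_iff, hφval]; exact List.sublist_append_right _ _) fun e => ?_
    have := congrArg (fun z : OSeq V => z.1.length) e
    simp only [hφval, List.length_append] at this
    exact w.1.2.1 (List.eq_nil_of_length_eq_zero (by omega))
  have hφl : ∀ w, l (φ w) = w.1.1 := fun w => by
    have hnd := (φ w).2.2
    rw [hφval, List.nodup_append] at hnd
    have hu' : u.1 = a :: u.1.tail := (List.cons_head_tail u.2.1).symm
    simp only [l]
    rw [hφval, hu', takeWhile_append_cons _ (by simp), List.filter_eq_self]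
    · exact fun x hx => by simpa using w.2.1 x hx
    · intro b hb
      simpa using fun e : b = a => hnd.2.2 b hb a hau e
  refine ((connectedPoset_range_iff φ d).2 h2).of_retraction_le (h := h) ?_ ?_ ?_ ?_ ?_
  · rintro _ ⟨w, rfl⟩
    refine ⟨hφF w, ?_, hφu w⟩
    simp only [hφval, List.head_append_of_ne_nil w.1.2.1]
    exact w.2.1 _ (List.head_mem _)
  · intro z hz z' hz' hzz'
    obtain ⟨w, r, h1, h2, h3, h4⟩ := key z hz.2.2.le
    obtain ⟨w', r', h1', h2', h3', h4'⟩ := key z' hz'.2.2.le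
    rw [le_iff, hval z hz.2.2.le, hval z' hz'.2.2.le, List.append_sublist_append_right, h4, h4']
    refine List.Sublist.filter _ ?_
    have hnd := z'.2.2
    rw [h1', List.nodup_append] at hnd
    have hs := le_iff.1 hzz'
    rw [h1, h1'] at hs
    have hwa : (w ++ [a]).Sublist (w' ++ a :: r') :=
      (List.Sublist.append_left (by simp) w).trans hs
    obtain ⟨l₁, l₂, e, e1, e2⟩ := List.sublist_append_iff.1 hwa
    rcases List.eq_nil_or_concat l₂ with rfl | ⟨l₃, b, e0⟩
    · rw [List.append_nil] at e
      exact absurd (e1.subset (e ▸ by simp)) h3'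
    · rw [List.concat_eq_append] at e0
      subst e0
      rw [← List.append_assoc] at e
      obtain ⟨e3, e4⟩ := List.append_inj' e rfl
      obtain rfl : a = b := by simpa using e4
      rcases List.sublist_cons_iff.1 e2 with e5 | ⟨l₄, e5, e6⟩
      · exact absurd (e5.subset (by simp)) (List.nodup_cons.1 hnd.2.1).1
      · cases l₃ with
        | nil => rw [e3, List.append_nil]; exact e1
        | cons c l₃ =>
          simp only [List.cons_append, List.cons.injEq] at e5
          exact absurd (e6.subset (e5.2 ▸ by simp)) (List.nodup_cons.1 hnd.2.1).1
  · rintro z ⟨hzF, hzX, hz⟩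
    have hF : h z ∈ F := hchain (hle z hz.le) hzF
    have hs := hsub z hz.le
    have hnd := z.2.2.sublist hs
    have hlF : mk (l z) (hlne z hzX hz.le) (List.nodup_append.1 hnd).1 ∈ F := by
      refine hchain ?_ hF
      rw [le_iff, hval z hz.le]
      exact List.sublist_append_left _ _
    refine ⟨⟨mk (l z) (hlne z hzX hz.le) (List.nodup_append.1 hnd).1, hlX z, hlF,
      ⟨by simp [u.2.1], hnd⟩, ?_⟩, ?_⟩
    · have e : h z = mk (l z ++ u.1) (by simp [u.2.1]) hnd := Subtype.ext (hval z hz.le)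
      rw [e] at hF
      exact hF
    · exact Subtype.ext (hval z hz.le).symm
  · rintro _ ⟨w, rfl⟩
    refine Subtype.ext ?_
    rw [hval _ (hφu w).le, hφl, hφval]
  · exact fun z hz => hle z hz.2.2.le

theorem connectedPoset_of_chainCondition (hchain : ChainCondition F)
    (h1 : ConnectedPoset d (SeqIn X ∩ F))
    (h2 : ∀ v ∈ F, v ∉ SeqIn X →
      ConnectedPoset (d - v.1.length) (univ : Set ↥(SeqIn X ∩ SeqExt F v))) :
    ConnectedPoset d F := by
  let S : ℕ → Set (OSeq V) := fun k => {z ∈ F | z.1.head z.2.1 ∈ X ∨ z.1.length ≤ k}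
  have hS : F = ⋃ k, S k := by
    ext z
    simp only [S, mem_iUnion, mem_ofPred_eq]
    exact ⟨fun h => ⟨_, h, Or.inr le_rfl⟩, fun ⟨_, h⟩ => h.1⟩
  rw [hS]
  refine ConnectedPoset.iUnion (fun j k hjk z hz => ⟨hz.1, hz.2.imp_right fun h => h.trans hjk⟩)
    fun k => ?_
  induction k with
  | zero =>
    convert connectedPoset_head_mem hchain h1 using 1
    ext z
    have : z.1.length ≠ 0 := fun h => z.2.1 (List.eq_nil_of_length_eq_zero h)
    simp [S, z.2.1]
  | succ k ih =>
    let T : Set (OSeq V) := {z ∈ F | z.1.head z.2.1 ∉ X ∧ z.1.length = k + 1}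
    have hST : S (k + 1) = S k ∪ T := by
      ext z
      simp only [S, T, mem_union, mem_ofPred_eq]
      by_cases hz : z.1.head z.2.1 ∈ X
      · simp [hz]
      · simp only [hz, false_or, not_false_eq_true, true_and]
        rw [← and_or_left, Nat.le_succ_iff]
    rw [hST]
    refine ih.union fun τ hτ => ?_
    obtain ⟨u, huτ⟩ := hτ.1
    obtain ⟨huF, huX, hul⟩ := hτ.2.1 huτ
    have hτu : ∀ t ∈ τ, t = u := fun t ht => by
      have htl := (hτ.2.1 ht).2.2
      rcases hτ.2.2.total ht huτ with h | h
      · exact eq_of_le_of_length_le h (by rw [htl, hul])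
      · exact (eq_of_le_of_length_le h (by rw [htl, hul])).symm
    obtain rfl : τ = {u} := Finset.eq_singleton_iff_unique_mem.2 ⟨huτ, hτu⟩
    have hlink : linkIn (S k) {u} =
        {z : OSeq V | z < u} ∪ {z ∈ F | z.1.head z.2.1 ∈ X ∧ u < z} := by
      ext z
      simp only [linkIn, S, mem_union, mem_ofPred_eq, Finset.mem_singleton, forall_eq]
      constructor
      · rintro ⟨⟨hzF, hz⟩, hzu⟩
        have hne : z ≠ u := by
          rintro rfl
          rcases hz with hz | hz
          · exact huX hz
          · omega
        rcases hzu with h | h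
        · exact Or.inl (lt_of_le_of_ne h hne)
        · have hlt := lt_of_le_of_ne h hne.symm
          have := length_lt_of_lt hlt
          exact Or.inr ⟨hzF, hz.resolve_right (by omega), hlt⟩
      · rintro (h | ⟨hzF, hzX, h⟩)
        · have := length_lt_of_lt h
          exact ⟨⟨hchain h.le huF, Or.inr (by omega)⟩, Or.inl h.le⟩
        · exact ⟨⟨hzF, Or.inl hzX⟩, Or.inr h.le⟩
    rw [hlink]
    refine (connectedPoset_join u (fun q hq => hq.2.2) (connectedPoset_above hchain huX
      (h2 u huF fun h => huX (h _ (List.head_mem u.2.1))))).mono ?_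
    omega

end ChainLemma

section Realization

/-- The characteristic map of a simplex `σ` of a simplicial set into its geometric realization. -/
noncomputable def charMap (S : SSet.{0}) {n : SimplexCategory} (σ : S.obj (.op n)) :
    C(stdSimplex ℝ (Fin (n.len + 1)), SSet.toTop.obj S) :=
  TopCat.toSSetObjEquiv _ (.op n) ((sSetTopAdj.unit.app S).app (.op n) σ)

theorem charMap_map (S : SSet.{0}) {n m : SimplexCategory} (θ : n ⟶ m) (σ : S.obj (.op m))
    (y : stdSimplex ℝ (Fin (n.len + 1))) :
    charMap S (S.map θ.op σ) y = charMap S σ (stdSimplex.map θ y) := by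
  have := ConcreteCategory.congr_hom ((sSetTopAdj.unit.app S).naturality θ.op) σ
  rw [charMap, charMap, ← TopCat.toSSetObjEquiv_naturality_apply]
  exact congrArg (fun z => TopCat.toSSetObjEquiv _ (.op n) z y) this

theorem charMap_comp (S : SSet.{0}) {Z : TopCat.{0}} (h : SSet.toTop.obj S ⟶ Z)
    {n : SimplexCategory} (σ : S.obj (.op n)) (y : stdSimplex ℝ (Fin (n.len + 1))) :
    h (charMap S σ y) = TopCat.toSSetObjEquiv Z (.op n) ((sSetTopAdj.homEquiv S Z h).app (.op n) σ) y := by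
  rw [Adjunction.homEquiv_unit]
  rfl

theorem exists_descent (S : SSet.{0}) {Z : Type} [TopologicalSpace Z]
    (φ : ∀ {n : SimplexCategory}, S.obj (.op n) → C(stdSimplex ℝ (Fin (n.len + 1)), Z))
    (hφ : ∀ {n m : SimplexCategory} (θ : n ⟶ m) (σ : S.obj (.op m))
      (y : stdSimplex ℝ (Fin (n.len + 1))), φ (S.map θ.op σ) y = φ σ (stdSimplex.map θ y)) :
    ∃ h : C(SSet.toTop.obj S, Z), ∀ {n : SimplexCategory} (σ : S.obj (.op n)) y,
      h (charMap S σ y) = φ σ y := by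
  let η : S ⟶ TopCat.toSSet.obj (TopCat.of Z) :=
    { app := fun n => ↾fun σ => (TopCat.toSSetObjEquiv (TopCat.of Z) n).symm (φ σ)
      naturality := fun n m θ => by
        ext σ
        refine (TopCat.toSSetObjEquiv (TopCat.of Z) m).injective (ContinuousMap.ext fun y => ?_)
        exact hφ θ.unop σ y }
  refine ⟨((sSetTopAdj.homEquiv S (TopCat.of Z)).symm η).hom, fun {n} σ y => ?_⟩
  refine (charMap_comp S ((sSetTopAdj.homEquiv S (TopCat.of Z)).symm η) σ y).trans ?_
  rw [Equiv.apply_symm_apply]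
  rfl

theorem descent_ext (S : SSet.{0}) {Z : Type} [TopologicalSpace Z]
    {h h' : C(SSet.toTop.obj S, Z)}
    (H : ∀ {n : SimplexCategory} (σ : S.obj (.op n)) y, h (charMap S σ y) = h' (charMap S σ y)) :
    h = h' := by
  have : TopCat.ofHom h = TopCat.ofHom h' := by
    refine (sSetTopAdj.homEquiv S (TopCat.of Z)).injective ?_
    ext n σ
    refine (TopCat.toSSetObjEquiv (TopCat.of Z) n).injective (ContinuousMap.ext fun y => ?_)
    have h1 := charMap_comp S (TopCat.ofHom h) (n := n.unop) σ y
    have h2 := charMap_comp S (TopCat.ofHom h') (n := n.unop) σ y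
    exact h1.symm.trans ((H (n := n.unop) σ y).trans h2)
  exact congrArg TopCat.Hom.hom this

theorem exists_charMap_eq (S : SSet.{0}) (x : SSet.toTop.obj S) :
    ∃ (n : SimplexCategory) (σ : S.obj (.op n)) (y : _), charMap S σ y = x := by
  let : TopologicalSpace Prop := ⊤
  have := descent_ext S (Z := Prop)
    (h := ⟨fun x => ∃ (n : SimplexCategory) (σ : S.obj (.op n)) (y : _), charMap S σ y = x,
      continuous_top⟩) (h' := ⟨fun _ => True, continuous_top⟩)
    (fun σ y => eq_true ⟨_, σ, y, rfl⟩)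
  exact of_eq_true (congrArg (fun h : C(_, Prop) => h x) this)

theorem isOpen_of_charMap (S : SSet.{0}) {U : Set (SSet.toTop.obj S)}
    (hU : ∀ {n : SimplexCategory} (σ : S.obj (.op n)), IsOpen (charMap S σ ⁻¹' U)) : IsOpen U := by
  obtain ⟨h, hh⟩ := exists_descent S (Z := Prop)
    (fun σ => ⟨fun y => charMap S σ y ∈ U, continuous_Prop.2 (hU σ)⟩)
    (fun θ σ y => by
      simp only [ContinuousMap.coe_mk, charMap_map])
  have : (h : _ → Prop) = U := by
    ext x
    obtain ⟨n, σ, y, rfl⟩ := exists_charMap_eq S x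
    exact iff_of_eq (hh σ y)
  rw [← this]
  exact continuous_Prop.1 h.continuous

end Realization

section Cells

variable {P : Type} [PartialOrder P]

/-- The geometric realization of the nerve of a poset. -/
abbrev NerveSpace (P : Type) [PartialOrder P] : Type := SSet.toTop.obj (nerve P)

/-- The characteristic map of a weakly increasing sequence of elements of a poset. -/
noncomputable def cell {n : ℕ} (σ : Fin (n + 1) →o P) :
    C(stdSimplex ℝ (Fin (n + 1)), NerveSpace P) :=
  charMap (nerve P) (n := .mk n) σ.monotone.functor

theorem cell_comp {n m : ℕ} (σ : Fin (m + 1) →o P) (θ : Fin (n + 1) →o Fin (m + 1))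
    (y : stdSimplex ℝ (Fin (n + 1))) : cell (σ.comp θ) y = cell σ (stdSimplex.map θ y) :=
  charMap_map (nerve P) (SimplexCategory.mkHom θ) (σ.monotone.functor) y

/-- The weakly increasing sequence underlying a simplex of the nerve. -/
def nerveOrderHom {n : SimplexCategory} (σ : (nerve P).obj (.op n)) : Fin (n.len + 1) →o P :=
  ⟨σ.obj, fun _ _ h => leOfHom (σ.map (homOfLE h))⟩

theorem exists_cell_eq (x : NerveSpace P) :
    ∃ (n : ℕ) (σ : Fin (n + 1) →o P) (y : stdSimplex ℝ (Fin (n + 1))), cell σ y = x := by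
  obtain ⟨n, σ, y, h⟩ := exists_charMap_eq (nerve P) x
  exact ⟨n.len, nerveOrderHom σ, y, h⟩

theorem isQuotientMap_cell : IsQuotientMap
    (fun z : Σ s : (Σ n : ℕ, Fin (n + 1) →o P), stdSimplex ℝ (Fin (s.1 + 1)) =>
      cell z.1.2 z.2) := by
  refine (isQuotientMap_iff _).2 ⟨isCoinducing_iff.2 fun U => ⟨fun h => ?_, fun h => h.preimage ?_⟩,
    fun x => ?_⟩
  · refine isOpen_of_charMap _ fun {n} σ => ?_
    exact isOpen_sigma_iff.1 h ⟨n.len, nerveOrderHom σ⟩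
  · exact continuous_sigma fun s => (cell s.2).continuous
  · obtain ⟨n, σ, y, h⟩ := exists_cell_eq x
    exact ⟨⟨⟨n, σ⟩, y⟩, h⟩

theorem exists_map_of_cell {Z : Type} [TopologicalSpace Z]
    (φ : ∀ {n : ℕ}, (Fin (n + 1) →o P) → stdSimplex ℝ (Fin (n + 1)) → Z)
    (hφc : ∀ {n : ℕ} (σ : Fin (n + 1) →o P), Continuous (φ σ))
    (hφ : ∀ {n m : ℕ} (σ : Fin (m + 1) →o P) (θ : Fin (n + 1) →o Fin (m + 1)) y,
      φ (σ.comp θ) y = φ σ (stdSimplex.map θ y)) :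
    ∃ h : C(NerveSpace P, Z), ∀ {n : ℕ} (σ : Fin (n + 1) →o P) y, h (cell σ y) = φ σ y := by
  obtain ⟨h, hh⟩ := exists_descent (nerve P)
    (fun σ => ⟨φ (nerveOrderHom σ), hφc _⟩)
    (fun θ σ y => hφ (nerveOrderHom σ) θ.toOrderHom y)
  exact ⟨h, fun {n} σ y => hh (n := .mk n) σ.monotone.functor y⟩

end Cells

section Coordinates

variable {P : Type} [PartialOrder P]

theorem stdSimplex_map_apply {ι κ : Type*} [Fintype ι] [Fintype κ] [DecidableEq κ] (θ : ι → κ)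
    (y : stdSimplex ℝ ι) (j : κ) : stdSimplex.map θ y j = ∑ i with θ i = j, y i := by
  rw [stdSimplex.map_coe, FunOnFinite.linearMap_apply_apply]

theorem stdSimplex_map_congr {ι κ : Type*} [Fintype ι] [Fintype κ] {θ θ' : ι → κ}
    (y : stdSimplex ℝ ι) (h : ∀ i, y i ≠ 0 → θ i = θ' i) :
    stdSimplex.map θ y = stdSimplex.map θ' y := by
  classical
  ext j
  rw [stdSimplex_map_apply, stdSimplex_map_apply, Finset.sum_filter, Finset.sum_filter]
  refine Finset.sum_congr rfl fun i _ => ?_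
  by_cases hi : y i = 0
  · simp [hi]
  · rw [h i hi]

theorem sum_filter_stdSimplex_map {ι κ : Type*} [Fintype ι] [Fintype κ] {Q : Type*} [DecidableEq Q]
    (f : κ → Q) (θ : ι → κ) (y : stdSimplex ℝ ι) (p : Q) :
    ∑ j with f j = p, stdSimplex.map θ y j = ∑ i with f (θ i) = p, y i := by
  classical
  simp only [stdSimplex_map_apply]
  rw [← Finset.sum_fiberwise_of_maps_to (s := Finset.univ.filter fun i => f (θ i) = p)
    (t := Finset.univ.filter fun j => f j = p) (g := θ) (by simp)]
  refine Finset.sum_congr rfl fun j hj => Finset.sum_congr ?_ fun _ _ => rfl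
  ext i
  simp only [Finset.mem_filter, Finset.mem_univ, true_and] at hj ⊢
  exact ⟨fun h => ⟨h ▸ hj, h⟩, fun h => h.2⟩

open Classical in
theorem exists_coord (P : Type) [PartialOrder P] : ∃ h : C(NerveSpace P, P → ℝ),
    ∀ {n : ℕ} (σ : Fin (n + 1) →o P) (y : stdSimplex ℝ (Fin (n + 1))),
      h (cell σ y) = fun p => ∑ i with σ i = p, y i := by
  refine exists_map_of_cell (fun {n} σ y p => ∑ i with σ i = p, y i) (fun {n} σ => ?_)
    (fun {n m} σ θ y => funext fun p => ?_)
  · refine continuous_pi fun p => continuous_finsetSum _ fun i _ => ?_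
    exact (continuous_apply i).comp continuous_subtype_val
  · exact (sum_filter_stdSimplex_map σ θ y p).symm

/-- The barycentric coordinates on the realization of the nerve of a poset. -/
noncomputable def coord : C(NerveSpace P, P → ℝ) := (exists_coord P).choose

open Classical in
theorem coord_cell {n : ℕ} (σ : Fin (n + 1) →o P) (y : stdSimplex ℝ (Fin (n + 1))) (p : P) :
    coord (cell σ y) p = ∑ i with σ i = p, y i :=
  congrFun ((exists_coord P).choose_spec σ y) p

theorem coord_cell_ne_zero {n : ℕ} {σ : Fin (n + 1) →o P} {y : stdSimplex ℝ (Fin (n + 1))} {p : P} :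
    coord (cell σ y) p ≠ 0 ↔ ∃ i, σ i = p ∧ y i ≠ 0 := by
  classical
  rw [coord_cell, Ne, Finset.sum_eq_zero_iff_of_nonneg fun i _ => stdSimplex.zero_le y i]
  simp

theorem coord_nonneg (x : NerveSpace P) (p : P) : 0 ≤ coord x p := by
  classical
  obtain ⟨n, σ, y, rfl⟩ := exists_cell_eq x
  rw [coord_cell]
  exact Finset.sum_nonneg fun i _ => stdSimplex.zero_le y i

theorem finite_coord_ne_zero (x : NerveSpace P) : {p | coord x p ≠ 0}.Finite := by
  obtain ⟨n, σ, y, rfl⟩ := exists_cell_eq x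
  refine (finite_range σ).subset fun p hp => ?_
  obtain ⟨i, hi, -⟩ := coord_cell_ne_zero.1 hp
  exact ⟨i, hi⟩

/-- The support of a point of the realization of the nerve of a poset. -/
noncomputable def supp (x : NerveSpace P) : Finset P := (finite_coord_ne_zero x).toFinset

theorem mem_supp {x : NerveSpace P} {p : P} : p ∈ supp x ↔ coord x p ≠ 0 := by simp [supp]

theorem exists_stdSimplex_ne_zero {n : ℕ} (y : stdSimplex ℝ (Fin (n + 1))) : ∃ i, y i ≠ 0 := by
  by_contra! h
  simpa [h] using stdSimplex.sum_eq_one y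

theorem supp_mem_chains (x : NerveSpace P) : supp x ∈ chains (univ : Set P) := by
  obtain ⟨n, σ, y, rfl⟩ := exists_cell_eq x
  refine ⟨?_, subset_univ _, fun p hp q hq _ => ?_⟩
  · obtain ⟨i, hi⟩ := exists_stdSimplex_ne_zero y
    exact ⟨σ i, mem_supp.2 (coord_cell_ne_zero.2 ⟨i, rfl, hi⟩)⟩
  · obtain ⟨i, rfl, -⟩ := coord_cell_ne_zero.1 (mem_supp.1 hp)
    obtain ⟨j, rfl, -⟩ := coord_cell_ne_zero.1 (mem_supp.1 hq)
    exact (le_total i j).imp (fun h => σ.monotone h) (fun h => σ.monotone h)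

theorem isOpen_subset_supp (c : Finset P) : IsOpen {x : NerveSpace P | c ⊆ supp x} := by
  have : {x : NerveSpace P | c ⊆ supp x} = ⋂ p ∈ c, {x | coord x p ≠ 0} := by
    ext x
    simp [Finset.subset_iff, mem_supp]
  rw [this]
  refine isOpen_biInter_finset fun p _ => isOpen_ne.preimage ?_
  exact (continuous_apply p).comp coord.continuous

theorem continuous_supp : Continuous (supp : NerveSpace P → Finset P) := by
  rw [← continuousOn_univ, continuousOn_finset_iff]
  exact fun x _ => mem_nhdsWithin_of_mem_nhds
    ((isOpen_subset_supp (supp x)).mem_nhds (Finset.Subset.refl _))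

theorem exists_retraction_fin {n : ℕ} (A : Finset (Fin (n + 1))) (hA : A.Nonempty) :
    ∃ κ : Fin (n + 1) →o Fin (n + 1), (∀ i, κ i ∈ A) ∧ ∀ i ∈ A, κ i = i := by
  have hne : ∀ i, (A.filter (· ≤ max i (A.min' hA))).Nonempty := fun i =>
    ⟨A.min' hA, Finset.mem_filter.2 ⟨A.min'_mem hA, le_max_right _ _⟩⟩
  refine ⟨⟨fun i => (A.filter (· ≤ max i (A.min' hA))).max' (hne i), fun i j hij => ?_⟩,
    fun i => ?_, fun i hi => ?_⟩
  · refine Finset.max'_subset _ fun a ha => ?_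
    rw [Finset.mem_filter] at ha ⊢
    exact ⟨ha.1, ha.2.trans (max_le_max_right _ hij)⟩
  · exact (Finset.mem_filter.1 (Finset.max'_mem _ (hne i))).1
  · have hm : max i (A.min' hA) = i := max_eq_left (A.min'_le i hi)
    refine le_antisymm ?_ ?_
    · exact (Finset.mem_filter.1 (Finset.max'_mem _ (hne i))).2.trans hm.le
    · exact Finset.le_max' _ _ (Finset.mem_filter.2 ⟨hi, hm.ge⟩)

theorem exists_cell_eq_of_section {n m : ℕ} (σ : Fin (n + 1) →o P)
    (y : stdSimplex ℝ (Fin (n + 1))) (σ' : Fin (m + 1) →o P) (s : P → Fin (m + 1))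
    (hs : ∀ p ∈ supp (cell σ y), σ' (s p) = p) :
    ∃ z : stdSimplex ℝ (Fin (m + 1)), cell σ y = cell σ' z ∧
      ∀ j, z j = ∑ p ∈ supp (cell σ y) with s p = j, coord (cell σ y) p := by
  classical
  obtain ⟨κ, hκA, hκ⟩ := exists_retraction_fin (Finset.univ.filter fun i => y i ≠ 0)
    (by simpa [Finset.filter_nonempty_iff] using exists_stdSimplex_ne_zero y)
  have hmem : ∀ {i}, y i ≠ 0 → σ i ∈ supp (cell σ y) := fun {i} hi =>
    mem_supp.2 (coord_cell_ne_zero.2 ⟨i, rfl, hi⟩)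
  have hκy : ∀ i, y (κ i) ≠ 0 := fun i => by simpa using hκA i
  let θ : Fin (n + 1) →o Fin (m + 1) := ⟨fun i => s (σ (κ i)), fun i j hij => by
    by_contra! h
    have h1 := σ'.monotone h.le
    rw [hs _ (hmem (hκy i)), hs _ (hmem (hκy j))] at h1
    have h2 := le_antisymm h1 (σ.monotone (κ.monotone hij))
    rw [h2] at h
    exact lt_irrefl _ h⟩
  have hθ : σ'.comp θ = σ.comp κ := OrderHom.ext _ _ (funext fun i => hs _ (hmem (hκy i)))
  have hmap : stdSimplex.map κ y = y := by
    refine (stdSimplex_map_congr (θ' := id) y fun i hi => hκ i (by simpa using hi)).trans ?_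
    exact stdSimplex.map_id_apply y
  refine ⟨stdSimplex.map θ y, ?_, fun j => ?_⟩
  · rw [← cell_comp, hθ, cell_comp, hmap]
  · rw [stdSimplex_map_congr (θ := θ) (θ' := fun i => s (σ i)) y
      (fun i hi => congrArg (fun k => s (σ k)) (hκ i (by simpa using hi))),
      stdSimplex_map_apply]
    simp only [coord_cell]
    rw [← Finset.sum_filter_ne_zero, Finset.filter_filter]
    rw [← Finset.sum_fiberwise_of_maps_to (g := σ)
      (t := (supp (cell σ y)).filter fun p => s p = j) (by
        intro i hi
        simp only [Finset.mem_filter, Finset.mem_univ, true_and] at hi ⊢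
        exact ⟨hmem hi.2, hi.1⟩)]
    refine Finset.sum_congr rfl fun p hp => ?_
    rw [← Finset.sum_filter_ne_zero (s := Finset.univ.filter fun i => σ i = p)]
    refine Finset.sum_congr ?_ fun _ _ => rfl
    ext i
    simp only [Finset.mem_filter, Finset.mem_univ, true_and] at hp ⊢
    exact ⟨fun h => ⟨h.2, h.1.2⟩, fun h => ⟨⟨h.1 ▸ hp.2, h.2⟩, h.1⟩⟩

theorem coord_injective : Function.Injective (coord : NerveSpace P → P → ℝ) := by
  intro x x' h
  obtain ⟨n, σ, y, rfl⟩ := exists_cell_eq x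
  obtain ⟨m, σ', y', rfl⟩ := exists_cell_eq x'
  have hsupp : supp (cell σ y) = supp (cell σ' y') := by
    ext p
    rw [mem_supp, mem_supp, h]
  have hex : ∀ p, ∃ j, p ∈ supp (cell σ' y') → σ' j = p := fun p => by
    by_cases hp : p ∈ supp (cell σ' y')
    · obtain ⟨j, hj, -⟩ := coord_cell_ne_zero.1 (mem_supp.1 hp)
      exact ⟨j, fun _ => hj⟩
    · exact ⟨0, fun h => absurd h hp⟩
  choose s hs using hex
  obtain ⟨z, hz, hzc⟩ := exists_cell_eq_of_section σ y σ' s (hsupp ▸ hs)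
  obtain ⟨z', hz', hzc'⟩ := exists_cell_eq_of_section σ' y' σ' s hs
  have : z = z' := by
    ext j
    rw [hzc, hzc', h, hsupp]
  rw [hz, hz', this]

end Coordinates

section Stars

variable {P : Type} [PartialOrder P]

/-- The open star of a chain in the realization of the nerve of a poset. -/
def openStar (c : Finset P) : Set (NerveSpace P) := {x | c ⊆ supp x}

theorem openStar_antitone : Antitone (openStar : Finset P → Set (NerveSpace P)) :=
  fun _ _ h _ hx => h.trans hx

theorem exists_orderHom_range {c : Finset P} (hc : c ∈ chains (univ : Set P)) :
    ∃ (n : ℕ) (σ : Fin (n + 1) →o P), ∀ p ∈ c, ∃ i, σ i = p := by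
  classical
  let : LinearOrder c :=
    { (inferInstance : PartialOrder c) with
      le_total := fun a b => (eq_or_ne a.1 b.1).elim (fun h => Or.inl h.le)
        (fun h => hc.2.2 a.2 b.2 h)
      toDecidableLE := Classical.decRel _ }
  have hcard : Fintype.card c = (c.card - 1) + 1 := by
    rw [Fintype.card_coe, Nat.sub_add_cancel hc.1.card_pos]
  let e := monoEquivOfFin c hcard
  exact ⟨c.card - 1, ⟨fun i => (e i : P), fun i j h => e.monotone h⟩,
    fun p hp => ⟨e.symm ⟨p, hp⟩, congrArg Subtype.val (e.apply_symm_apply ⟨p, hp⟩)⟩⟩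

open Classical in
/-- The barycentric coordinates of the barycenter of `c`. -/
noncomputable def barycenterCoord (c : Finset P) (p : P) : ℝ :=
  if p ∈ c then (c.card : ℝ)⁻¹ else 0

theorem exists_coord_eq_barycenterCoord {c : Finset P} (hc : c.Nonempty) {n : ℕ}
    (σ : Fin (n + 1) →o P) (hσ : ∀ p ∈ c, ∃ i, σ i = p) :
    ∃ b : stdSimplex ℝ (Fin (n + 1)), coord (cell σ b) = barycenterCoord c := by
  classical
  choose! s hs using hσ
  have : Nonempty c := hc.to_subtype
  refine ⟨stdSimplex.map (fun p : c => s p) stdSimplex.barycenter, funext fun p => ?_⟩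
  rw [coord_cell]
  refine (sum_filter_stdSimplex_map σ _ _ p).trans ?_
  have hcongr : (Finset.univ.filter fun q : c => σ (s q) = p) =
      Finset.univ.filter fun q : c => (q : P) = p := by
    refine Finset.filter_congr fun q _ => ?_
    rw [hs q q.2]
  have hb : ∀ q : c, (stdSimplex.barycenter : stdSimplex ℝ c) q = (c.card : ℝ)⁻¹ := fun q => by
    rw [← Fintype.card_coe]
    rfl
  rw [hcongr, barycenterCoord]
  split_ifs with hp
  · rw [Finset.sum_eq_single_of_mem ⟨p, hp⟩ (by simp), hb]
    exact fun q hq hqp => absurd (Subtype.ext (Finset.mem_filter.1 hq).2) hqp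
  · rw [Finset.filter_false_of_mem, Finset.sum_empty]
    rintro q - rfl
    exact hp q.2

/-- The straight-line contraction of the open star of `c` to the barycenter of `c`. -/
noncomputable def starContraction (c : Finset P) (t : ℝ) (x : NerveSpace P) : NerveSpace P :=
  haveI : Nonempty (NerveSpace P) := ⟨x⟩
  Function.invFun coord ((1 - t) • coord x + t • barycenterCoord c)

theorem starContraction_eq {c : Finset P} {t : ℝ} {x z : NerveSpace P}
    (h : coord z = (1 - t) • coord x + t • barycenterCoord c) : starContraction c t x = z := by
  have : Nonempty (NerveSpace P) := ⟨x⟩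
  rw [starContraction, ← h]
  exact Function.leftInverse_invFun coord_injective z

/-- The segment between two points of the standard simplex. -/
def simplexSegment {ι : Type*} [Fintype ι] (b : stdSimplex ℝ ι) (t : unitInterval)
    (y : stdSimplex ℝ ι) : stdSimplex ℝ ι :=
  ⟨(1 - (t : ℝ)) • y.1 + (t : ℝ) • b.1, convex_stdSimplex ℝ ι y.2 b.2 (by linarith [t.2.2]) t.2.1
    (by ring)⟩

theorem coord_cell_simplexSegment {n : ℕ} (σ : Fin (n + 1) →o P)
    (b y : stdSimplex ℝ (Fin (n + 1))) (t : unitInterval) :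
    coord (cell σ (simplexSegment b t y)) =
      (1 - (t : ℝ)) • coord (cell σ y) + (t : ℝ) • coord (cell σ b) := by
  classical
  ext p
  simp only [Pi.add_apply, Pi.smul_apply, coord_cell, smul_eq_mul, Finset.mul_sum,
    ← Finset.sum_add_distrib]
  rfl

theorem exists_starContraction_cell {c : Finset P} (hc : c.Nonempty) {n : ℕ}
    (σ : Fin (n + 1) →o P) {y₀ : stdSimplex ℝ (Fin (n + 1))} (hy : cell σ y₀ ∈ openStar c) :
    ∃ b : stdSimplex ℝ (Fin (n + 1)), ∀ (t : unitInterval) y,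
      starContraction c t (cell σ y) = cell σ (simplexSegment b t y) := by
  obtain ⟨b, hb⟩ := exists_coord_eq_barycenterCoord hc σ fun p hp => by
    obtain ⟨i, hi, -⟩ := coord_cell_ne_zero.1 (mem_supp.1 (hy hp))
    exact ⟨i, hi⟩
  exact ⟨b, fun t y => starContraction_eq (by rw [coord_cell_simplexSegment, hb])⟩

theorem coord_starContraction {c : Finset P} (hc : c.Nonempty) (t : unitInterval)
    {x : NerveSpace P} (hx : x ∈ openStar c) :
    coord (starContraction c t x) = (1 - (t : ℝ)) • coord x + (t : ℝ) • barycenterCoord c := by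
  obtain ⟨n, σ, y, rfl⟩ := exists_cell_eq x
  obtain ⟨b, hb⟩ := exists_coord_eq_barycenterCoord hc σ fun p hp => by
    obtain ⟨i, hi, -⟩ := coord_cell_ne_zero.1 (mem_supp.1 (hx hp))
    exact ⟨i, hi⟩
  have := coord_cell_simplexSegment σ b y t
  rw [hb] at this
  rw [starContraction_eq this, this]

theorem starContraction_mem {c : Finset P} (hc : c.Nonempty) (t : unitInterval)
    {x : NerveSpace P} (hx : x ∈ openStar c) : starContraction c t x ∈ openStar c := by
  intro p hp
  have hx' : 0 < coord x p := lt_of_le_of_ne (coord_nonneg x p) (mem_supp.1 (hx hp)).symm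
  have hcard : (0 : ℝ) < (c.card : ℝ)⁻¹ := inv_pos.2 (Nat.cast_pos.2 hc.card_pos)
  rw [mem_supp, coord_starContraction hc t hx]
  simp only [Pi.add_apply, Pi.smul_apply, smul_eq_mul, barycenterCoord, if_pos hp]
  rcases t.2.1.eq_or_lt with h | h
  · rw [← h]
    simpa using hx'.ne'
  · exact (add_pos_of_nonneg_of_pos (mul_nonneg (by linarith [t.2.2]) hx'.le)
      (mul_pos h hcard)).ne'

theorem continuous_simplexSegment {ι : Type*} [Fintype ι] (b : stdSimplex ℝ ι) :
    Continuous fun q : stdSimplex ℝ ι × unitInterval => simplexSegment b q.2 q.1 := by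
  refine Continuous.subtype_mk ?_ _
  fun_prop

theorem isOpen_openStar (c : Finset P) : IsOpen (openStar c) := isOpen_subset_supp c

theorem isQuotientMap_openStar (c : Finset P) : IsQuotientMap
    (fun z : Σ s : (Σ n : ℕ, Fin (n + 1) →o P), {y // cell s.2 y ∈ openStar c} =>
      (⟨cell z.1.2 z.2.1, z.2.2⟩ : openStar c)) := by
  refine (isQuotientMap_iff _).2 ⟨isCoinducing_iff.2 fun U => ⟨fun h => ?_, fun h => h.preimage ?_⟩,
    fun x => ?_⟩
  · rw [(isOpen_openStar c).isOpenEmbedding_subtypeVal.isOpen_iff_image_isOpen]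
    rw [← isQuotientMap_cell.isOpen_preimage, isOpen_sigma_iff]
    intro s
    have hs := isOpen_sigma_iff.1 h s
    have ho : IsOpen {y | cell s.2 y ∈ openStar c} :=
      (isOpen_openStar c).preimage (cell s.2).continuous
    convert ho.isOpenEmbedding_subtypeVal.isOpenMap _ hs using 1
    ext y
    constructor
    · rintro ⟨⟨x, hxc⟩, hx, hxy⟩
      obtain rfl : x = cell s.2 y := hxy
      exact ⟨⟨y, hxc⟩, hx, rfl⟩
    · rintro ⟨y, hy, rfl⟩
      exact ⟨_, hy, rfl⟩
  · exact continuous_sigma fun s => Continuous.subtype_mk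
      ((cell s.2).continuous.comp continuous_subtype_val) _
  · obtain ⟨n, σ, y, h⟩ := exists_cell_eq x.1
    exact ⟨⟨⟨n, σ⟩, ⟨y, h ▸ x.2⟩⟩, Subtype.ext h⟩

theorem continuous_starContraction {c : Finset P} (hc : c.Nonempty) :
    Continuous fun q : openStar c × unitInterval => starContraction c q.2 q.1 := by
  refine (isQuotientMap_openStar c).continuous_lift_prod_left ?_
  refine Homeomorph.sigmaProdDistrib.symm.comp_continuous_iff'.1 (continuous_sigma fun s => ?_)
  refine continuous_iff_continuousAt.2 fun q₀ => Continuous.continuousAt ?_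
  obtain ⟨b, hb⟩ := exists_starContraction_cell hc s.2 q₀.1.2
  refine Continuous.congr (f := fun q : {y // cell s.2 y ∈ openStar c} × unitInterval =>
    cell s.2 (simplexSegment b q.2 q.1)) ?_ fun q => (hb q.2 q.1).symm
  exact (cell s.2).continuous.comp ((continuous_simplexSegment b).comp
    (continuous_subtype_val.prodMap continuous_id))

theorem fillsSpheres_openStar {ι : Type*} [Fintype ι] {c : Finset P}
    (hc : c ∈ chains (univ : Set P)) : FillsSpheres ι (openStar c) := by
  obtain ⟨n, σ, hσ⟩ := exists_orderHom_range hc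
  obtain ⟨b, hb⟩ := exists_coord_eq_barycenterCoord hc.1 σ hσ
  have hbc : cell σ b ∈ openStar c := fun p hp => by
    rw [mem_supp, hb, barycenterCoord, if_pos hp]
    exact inv_ne_zero (Nat.cast_ne_zero.2 hc.1.card_pos.ne')
  refine ⟨⟨_, hbc⟩, fun g hg hgS => ?_⟩
  refine Fills.of_homotopy (fun q => starContraction c q.1 (g q.2)) ?_ ?_ ?_ ?_
  · rw [continuousOn_iff_continuous_domRestrict]
    refine (continuous_starContraction hc.1).comp
      (f := fun q : (Icc (0 : ℝ) 1 ×ˢ sphere (0 : ι → ℝ) 1 : Set (ℝ × (ι → ℝ))) =>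
        ((⟨g q.1.2, hgS q.2.2⟩ : openStar c), (⟨q.1.1, q.2.1⟩ : unitInterval))) ?_
    refine Continuous.prodMk (Continuous.subtype_mk ?_ _) (Continuous.subtype_mk ?_ _)
    · exact hg.comp_continuous (continuous_snd.comp continuous_subtype_val) fun q => q.2.2
    · exact continuous_fst.comp continuous_subtype_val
  · rintro ⟨t, x⟩ ⟨ht, hx⟩
    exact starContraction_mem hc.1 ⟨t, ht⟩ (hgS hx)
  · exact fun x hx => starContraction_eq (by simp)
  · exact (fills_const hbc).congr fun x hx => (starContraction_eq (by simp [hb])).symm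

theorem connectedPoset_univ_iff (d : ℤ) :
    ConnectedPoset d (univ : Set P) ↔ PosetDConnected P d := by
  classical
  have hne : ∀ c ∈ chains (univ : Set P), c.Nonempty := fun c hc => hc.1
  have hlow : ∀ c ∈ chains (univ : Set P), ∀ c' ⊆ c, c'.Nonempty → c' ∈ chains (univ : Set P) :=
    fun c hc c' h h' => chains_lower hc h h'
  rw [PosetDConnected, topDConnected_iff]
  refine ⟨fun h k hk => ⟨?_, fun g hg _ => ?_⟩, fun h k hk => ⟨?_, fun f hf hfS => ?_⟩⟩
  · obtain ⟨c, hc⟩ := (h k hk).1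
    exact (fillsSpheres_openStar (ι := Fin 0) hc).1.mono (subset_univ _)
  · obtain ⟨f, hf, hfg, hfS⟩ := (h k hk).2 (fun x => supp (g x))
      (continuous_supp.comp_continuousOn hg) fun x _ => supp_mem_chains _
    obtain ⟨G, hG, hGg⟩ := exists_carried_extension_ball hf hne hlow hfS openStar_antitone
      (fun c hc k _ => fillsSpheres_openStar hc) hg
      (fun x hx => (hfg hx).subset)
    exact ⟨G, hG, hGg, fun _ _ => mem_univ _⟩
  · obtain ⟨x, -⟩ := (h k hk).1
    exact ⟨_, supp_mem_chains x⟩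
  · have : Nonempty (NerveSpace P) := (h k hk).1.to_subtype.map Subtype.val
    obtain ⟨g, hg, hgf⟩ := exists_carried_map_sphere hf hne hlow hfS openStar_antitone
      (fun c hc k _ => fillsSpheres_openStar hc)
    have hsg : ContinuousOn (fun x => supp (g x)) (sphere 0 1) :=
      continuous_supp.comp_continuousOn hg
    have hsgS : MapsTo (fun x => supp (g x)) (sphere 0 1) (chains (univ : Set P)) :=
      fun x _ => supp_mem_chains _
    have hi : ContinuousOn (fun x => f x ∩ supp (g x)) (sphere 0 1) := hf.finset_inter hsg
    have hiS : MapsTo (fun x => f x ∩ supp (g x)) (sphere 0 1) (chains (univ : Set P)) := by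
      intro x hx
      obtain ⟨c, hc, hcf, hcg⟩ := hgf x hx
      exact hlow _ (hfS hx) _ Finset.inter_subset_left
        (hc.1.mono (Finset.subset_inter hcf hcg))
    have hF : Fills (chains (univ : Set P)) (fun x => supp (g x)) :=
      ((h k hk).2 g hg fun _ _ => mem_univ _).comp continuous_supp.continuousOn
        fun x _ => supp_mem_chains x
    refine Fills.of_subset ?_ hf hfS hi hiS fun x _ => Finset.inter_subset_left
    exact hF.of_superset hi hiS hsg hsgS fun x _ => Finset.inter_subset_right

end Stars

theorem setDConnected_iff {V : Type} (F : Set (OSeq V)) (d : ℤ) :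
    SetDConnected F d ↔ ConnectedPoset d F := by
  have := connectedPoset_range_iff (OrderEmbedding.subtype (· ∈ F)) d
  rw [OrderEmbedding.coe_subtype, Subtype.range_coe] at this
  exact (connectedPoset_univ_iff d).symm.trans this.symm

end Connectivity

/-- (Lemma 2.13 (1)) Let `F ⊆ U(M^∞)` satisfy the chain condition and let
`X ⊆ M^∞`. If `O(X) ∩ F` is `d`-connected and for every `(v_1, …, v_m) ∈ F \ O(X)` the poset
`O(X) ∩ F_{(v_1, …, v_m)}` is `(d − m)`-connected, then `F` is `d`-connected. -/
theorem chainLemma_one (R : Type) [Ring R] (M : Type) [AddCommGroup M] [Module Rᵐᵒᵖ M]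
    (F : Set (OSeq (MInf R M))) (X : Set (MInf R M)) (d : ℤ)
    (hFU : F ⊆ UnimodSeqs R (MInf R M))
    (hchain : ChainCondition F)
    (h1 : SetDConnected (SeqIn X ∩ F) d)
    (h2 : ∀ v ∈ F, v ∉ SeqIn X →
      SetDConnected (SeqIn X ∩ SeqExt F v) (d - v.1.length)) :
    SetDConnected F d := by
  refine (setDConnected_iff F d).2 (connectedPoset_of_chainCondition hchain
    ((setDConnected_iff _ d).1 h1) fun v hv hvX => ?_)
  exact (connectedPoset_univ_iff _).2 (h2 v hv hvX)
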